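/- Let 0 < α < 1 and β ∈ [0,1]. There exists a constant c > 0, depending only on α and β, with the following property. Let V be a nontrivial finite-dimensional complex inner product space, A : V → V a self-adjoint positive definite linear operator, v ∈ V, and let u : [0,∞) → V be continuous with u(0) = v, differentiable on (0,∞), such that for every t > 0 the function s ↦ (t-s)^{-α} ‖u'(s)‖ is integrable on (0,t) and ∂_t^α u(t) + A u(t) = 0, where ∂_t^α u(t) = (1/Γ(1-α)) ∫_0^t (t-s)^{-α} u'(s) ds. Let y(t) = u(t) - v. Then for every τ > 0 and every integer n ≥ 1, ‖A^β ( ∂_t^α u(t_n) - ∂̄_τ^α y(t_n) )‖ ≤ c · τ · t_n^{-1 - βα} · ‖A v‖, where t_k = kτ and ∂̄_τ^α y(t_n) = τ^{-α} Σ_{j=0}^n b_j^{(α)} y(t_{n-j}). -/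

import Mathlib

open scoped ComplexInnerProductSpace

/-- The backward Euler convolution quadrature weights `b_j^(α) = (-1)^j binom(α, j)`. -/
noncomputable def cqWeight (α : ℝ) (j : ℕ) : ℝ :=
  (-1 : ℝ) ^ j * (∏ i ∈ Finset.range j, (α - i)) / (Nat.factorial j)

/-- The Caputo derivative `∂_t^α u(t) = (1/Γ(1-α)) ∫_0^t (t-s)^{-α} u'(s) ds`,
expressed through the derivative function `u'`. -/
noncomputable def caputo (α : ℝ) {V : Type} [NormedAddCommGroup V] [NormedSpace ℝ V]
    (u' : ℝ → V) (t : ℝ) : V :=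
  (1 / Real.Gamma (1 - α)) • ∫ s in Set.Ioo 0 t, ((t - s) ^ (-α) : ℝ) • u' s

/-- Fractional power `A^β` via the functional (spectral) calculus. -/
noncomputable def opRPow {V : Type} [NormedAddCommGroup V] [InnerProductSpace ℂ V]
    [FiniteDimensional ℂ V] (A : V →L[ℂ] V) (β : ℝ) : V →L[ℂ] V :=
  cfc (fun x : ℝ => x ^ β) A

namespace FracCQ
open MeasureTheory Set Filter Topology

/-- Wendel's inequality, a consequence of the logarithmic convexity of `Γ`. -/
lemma Gamma_add_le_mul_rpow {x s : ℝ} (hx : 0 < x) (hs : 0 < s) (hs1 : s < 1) :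
    Real.Gamma (x + s) ≤ Real.Gamma x * x ^ s := by
  have h := Real.Gamma_mul_add_mul_le_rpow_Gamma_mul_rpow_Gamma hx (add_pos hx one_pos)
    (sub_pos.2 hs1) hs (by ring)
  have hG := Real.Gamma_pos_of_pos hx
  calc Real.Gamma (x + s) = Real.Gamma ((1 - s) * x + s * (x + 1)) := by congr 1; ring
    _ ≤ _ := h
    _ = Real.Gamma x * x ^ s := by
      rw [Real.Gamma_add_one hx.ne', Real.mul_rpow hx.le hG.le, mul_left_comm,
        ← Real.rpow_add hG]
      simp [mul_comm]

/-- The kernel `t ^ (γ - 1) / Γ(γ)` of the Riemann–Liouville integral of order `γ`. -/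
noncomputable def fracKernel (γ t : ℝ) : ℝ := t ^ (γ - 1) / Real.Gamma γ

lemma fracKernel_nonneg {γ t : ℝ} (hγ : 0 < γ) (ht : 0 ≤ t) : 0 ≤ fracKernel γ t :=
  div_nonneg (Real.rpow_nonneg ht _) (Real.Gamma_pos_of_pos hγ).le

lemma fracKernel_one (t : ℝ) : fracKernel 1 t = 1 := by simp [fracKernel]

lemma measurable_fracKernel (γ : ℝ) : Measurable (fracKernel γ) := by
  unfold fracKernel; fun_prop

lemma intervalIntegrable_fracKernel {γ : ℝ} (hγ : 0 < γ) (a b : ℝ) :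
    IntervalIntegrable (fracKernel γ) volume a b :=
  (intervalIntegral.intervalIntegrable_rpow' (by linarith)).div_const _

lemma integral_fracKernel {γ : ℝ} (hγ : 0 < γ) (a b : ℝ) :
    ∫ s in a..b, fracKernel γ s =
      (b ^ γ - a ^ γ) / Real.Gamma (γ + 1) := by
  unfold fracKernel
  rw [intervalIntegral.integral_div, integral_rpow (Or.inl (by linarith)),
    Real.Gamma_add_one hγ.ne', sub_add_cancel, div_div]

lemma intervalIntegrable_of_complex {f : ℝ → ℝ} {a b : ℝ}
    (h : IntervalIntegrable (fun x => (f x : ℂ)) volume a b) :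
    IntervalIntegrable f volume a b :=
  ⟨h.1.re, h.2.re⟩

lemma beta_unit {γ b : ℝ} (hγ : 0 < γ) (hb : 0 < b) :
    IntervalIntegrable (fun x : ℝ => x ^ (b - 1) * (1 - x) ^ (γ - 1)) volume 0 1 ∧
    ∫ x in (0:ℝ)..1, x ^ (b - 1) * (1 - x) ^ (γ - 1) =
      Real.Gamma γ * Real.Gamma b / Real.Gamma (γ + b) := by
  have key : ∀ x ∈ uIcc (0:ℝ) 1, ((x ^ (b - 1) * (1 - x) ^ (γ - 1) : ℝ) : ℂ) =
      (x : ℂ) ^ ((b : ℂ) - 1) * (1 - (x : ℂ)) ^ ((γ : ℂ) - 1) := by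
    intro x hx
    rw [uIcc_of_le zero_le_one] at hx
    rw [Complex.ofReal_mul, Complex.ofReal_cpow hx.1, Complex.ofReal_cpow (by linarith [hx.2])]
    push_cast; rfl
  have hc := Complex.betaIntegral_convergent (u := b) (v := γ) (by simpa) (by simpa)
  refine ⟨intervalIntegrable_of_complex (hc.congr fun x hx => (key x (uIoc_subset_uIcc hx)).symm),
    ?_⟩
  have h2 := Complex.betaIntegral_eq_Gamma_mul_div b γ (by simpa) (by simpa)
  unfold Complex.betaIntegral at h2
  rw [← intervalIntegral.integral_congr key, intervalIntegral.integral_ofReal,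
    Complex.Gamma_ofReal, Complex.Gamma_ofReal, ← Complex.ofReal_add, Complex.Gamma_ofReal] at h2
  rw [add_comm γ b, mul_comm (Real.Gamma γ)]
  exact_mod_cast h2

lemma fracKernel_conv {γ b t : ℝ} (hγ : 0 < γ) (hb : 0 < b) (ht : 0 < t) :
    IntervalIntegrable (fun s => fracKernel γ (t - s) * fracKernel b s) volume 0 t ∧
    ∫ s in 0..t, fracKernel γ (t - s) * fracKernel b s = fracKernel (γ + b) t := by
  obtain ⟨h1, h2⟩ := beta_unit hγ hb
  have hG := (Real.Gamma_pos_of_pos hγ).ne'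
  have hG' := (Real.Gamma_pos_of_pos hb).ne'
  have key : ∀ s ∈ uIcc (0:ℝ) t, fracKernel γ (t - s) * fracKernel b s =
      (t ^ (γ + b - 2) / (Real.Gamma γ * Real.Gamma b)) *
        ((s / t) ^ (b - 1) * (1 - s / t) ^ (γ - 1)) := by
    intro s hs
    rw [uIcc_of_le ht.le] at hs
    have e : 1 - s / t = (t - s) / t := by field_simp
    rw [e, Real.div_rpow hs.1 ht.le, Real.div_rpow (by linarith [hs.2]) ht.le,
      show γ + b - 2 = (b - 1) + (γ - 1) by ring, Real.rpow_add ht]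
    have := (Real.rpow_pos_of_pos ht (b - 1)).ne'
    have := (Real.rpow_pos_of_pos ht (γ - 1)).ne'
    unfold fracKernel
    field_simp
  constructor
  · have h3 := (h1.comp_mul_left (c := t⁻¹)).const_mul
      (t ^ (γ + b - 2) / (Real.Gamma γ * Real.Gamma b))
    simp only [zero_div, one_div, inv_inv] at h3
    refine h3.congr fun s hs => ?_
    rw [key s (uIoc_subset_uIcc hs), div_eq_inv_mul s t]
  · rw [intervalIntegral.integral_congr key, intervalIntegral.integral_const_mul,
      intervalIntegral.integral_comp_div (fun x : ℝ => x ^ (b - 1) * (1 - x) ^ (γ - 1)) ht.ne',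
      zero_div, div_self ht.ne', h2, fracKernel, smul_eq_mul,
      show γ + b - 1 = γ + b - 2 + 1 by ring, Real.rpow_add ht, Real.rpow_one]
    field_simp

/-- Associativity of convolution on the half line, for nonnegative kernels `f` and `g` whose
convolution is `Q`. -/
lemma conv_assoc {F : Type*} [NormedAddCommGroup F] [NormedSpace ℝ F] [CompleteSpace F]
    {f g Q : ℝ → ℝ} {h : ℝ → F} {t : ℝ} (ht : 0 < t)
    (hf : ContinuousOn f (Ioi 0)) (hg : ContinuousOn g (Ioi 0))
    (hh : AEStronglyMeasurable h (volume.restrict (Ioo 0 t)))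
    (hf0 : ∀ x, 0 < x → 0 ≤ f x) (hg0 : ∀ x, 0 < x → 0 ≤ g x)
    (hQ : ∀ x, 0 < x → IntervalIntegrable (fun s => f (x - s) * g s) volume 0 x ∧
      ∫ s in 0..x, f (x - s) * g s = Q x)
    (hQh : IntegrableOn (fun r => Q (t - r) * ‖h r‖) (Ioo 0 t)) :
    ∫ s in 0..t, f (t - s) • ∫ r in 0..s, g (s - r) • h r = ∫ r in 0..t, Q (t - r) • h r := by
  classical
  have meas : ∀ {φ : ℝ → ℝ}, ContinuousOn φ (Ioi 0) → Measurable ((Ioi 0).indicator φ) := by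
    intro φ hφ
    rw [← piecewise_eq_indicator]
    exact hφ.measurable_piecewise continuousOn_const measurableSet_Ioi
  set f₁ := (Ioi (0:ℝ)).indicator f with hf₁
  set g₁ := (Ioi (0:ℝ)).indicator g with hg₁
  have mf := meas hf
  have mg := meas hg
  have f₁0 : ∀ x, 0 ≤ f₁ x := fun x => indicator_nonneg (fun x hx => hf0 x hx) x
  have g₁0 : ∀ x, 0 ≤ g₁ x := fun x => indicator_nonneg (fun x hx => hg0 x hx) x
  have inner : ∀ r ∈ Ioo 0 t, IntegrableOn (fun s => f₁ (t - s) * g₁ (s - r)) (Ioo 0 t) ∧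
      ∫ s in Ioo 0 t, f₁ (t - s) * g₁ (s - r) = Q (t - r) := by
    intro r hr
    have e : (fun s => f₁ (t - s) * g₁ (s - r)) =
        (Ioo r t).indicator (fun s => f (t - s) * g (s - r)) := by
      ext s
      simp only [hf₁, hg₁, indicator, mem_Ioi, mem_Ioo, sub_pos]
      split_ifs <;> simp_all
    obtain ⟨i1, i2⟩ := hQ (t - r) (sub_pos.2 hr.2)
    have i3 := i1.comp_sub_right r
    simp only [zero_add, sub_add_cancel, sub_sub_sub_cancel_right] at i3
    have i4 := intervalIntegral.integral_comp_sub_right (a := r) (b := t)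
      (fun s => f (t - r - s) * g s) r
    simp only [sub_self, sub_sub_sub_cancel_right] at i4
    have hsub : Ioo 0 t ∩ Ioo r t = Ioo r t :=
      inter_eq_right.2 (Ioo_subset_Ioo_left hr.1.le)
    rw [e]
    constructor
    · rw [integrableOn_indicator_iff measurableSet_Ioo, inter_comm, hsub,
        ← integrableOn_Ioc_iff_integrableOn_Ioo]
      exact (intervalIntegrable_iff_integrableOn_Ioc_of_le hr.2.le).1 i3
    · rw [setIntegral_indicator measurableSet_Ioo, hsub, ← integral_Ioc_eq_integral_Ioo,
        ← intervalIntegral.integral_of_le hr.2.le, i4, i2]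
  have hmeas : AEStronglyMeasurable
      (Function.uncurry fun s r => (f₁ (t - s) * g₁ (s - r)) • h r)
      ((volume.restrict (Ioo 0 t)).prod (volume.restrict (Ioo 0 t))) := by
    have : Measurable fun p : ℝ × ℝ => f₁ (t - p.1) * g₁ (p.1 - p.2) :=
      (mf.comp (by fun_prop)).mul (mg.comp (by fun_prop))
    exact this.aestronglyMeasurable.smul hh.comp_snd
  have h_integral : Integrable (Function.uncurry fun s r => (f₁ (t - s) * g₁ (s - r)) • h r)
      ((volume.restrict (Ioo 0 t)).prod (volume.restrict (Ioo 0 t))) := by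
    rw [integrable_prod_iff' hmeas]
    constructor
    · filter_upwards [ae_restrict_mem measurableSet_Ioo] with r hr
      exact (inner r hr).1.smul_const (h r)
    · refine hQh.congr ?_
      filter_upwards [ae_restrict_mem measurableSet_Ioo] with r hr
      simp only [Function.uncurry, norm_smul, Real.norm_eq_abs,
        abs_of_nonneg (mul_nonneg (f₁0 _) (g₁0 _))]
      rw [integral_mul_const, (inner r hr).2]
  have swap := integral_integral_swap h_integral
  rw [intervalIntegral.integral_of_le ht.le, intervalIntegral.integral_of_le ht.le,
    integral_Ioc_eq_integral_Ioo, integral_Ioc_eq_integral_Ioo]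
  calc _ = ∫ s in Ioo 0 t, ∫ r in Ioo 0 t, (f₁ (t - s) * g₁ (s - r)) • h r := by
        refine setIntegral_congr_fun measurableSet_Ioo fun s hs => ?_
        have e : (fun r => (f₁ (t - s) * g₁ (s - r)) • h r) =
            (Iio s).indicator (fun r => f (t - s) • g (s - r) • h r) := by
          ext r
          have : t - s ∈ Ioi (0:ℝ) := sub_pos.2 hs.2
          simp only [hf₁, hg₁, indicator, this, mem_Ioi, mem_Iio, sub_pos]
          split_ifs <;> simp_all [mul_smul]
        have hsub : Ioo 0 t ∩ Iio s = Ioo 0 s := by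
          ext r; simp only [mem_inter_iff, mem_Ioo, mem_Iio]
          have := hs.2
          constructor
          · rintro ⟨⟨a, b⟩, c⟩; exact ⟨a, c⟩
          · rintro ⟨a, c⟩; exact ⟨⟨a, by linarith⟩, c⟩
        rw [e, setIntegral_indicator measurableSet_Iio, hsub, integral_smul,
          intervalIntegral.integral_of_le hs.1.le, integral_Ioc_eq_integral_Ioo]
    _ = ∫ r in Ioo 0 t, ∫ s in Ioo 0 t, (f₁ (t - s) * g₁ (s - r)) • h r := swap
    _ = _ := by
        refine setIntegral_congr_fun measurableSet_Ioo fun r hr => ?_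
        rw [integral_smul_const, (inner r hr).2]

section Series

lemma hasSum_congr {f g : ℕ → ℝ} {a : ℝ} (h : ∀ j, f j = g j) :
    HasSum f a ↔ HasSum g a := by
  rw [funext h]

lemma summable_sq_mul_rpow_div_Gamma {α β t : ℝ} (hα : 0 < α) (hα1 : α < 1) (hβ : 0 < β)
    (ht : 0 < t) :
    Summable fun j : ℕ => ((j : ℝ) + 1) ^ 2 * (t ^ (α * j) / Real.Gamma (α * j + β)) := by
  have hx : Tendsto (fun j : ℕ => α * (j : ℝ) + β) atTop atTop :=
    tendsto_atTop_add_const_right _ _ (tendsto_natCast_atTop_atTop.const_mul_atTop hα)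
  have h0 := (tendsto_rpow_neg_atTop hα).comp hx
  have hpos : 0 < 1 / (16 * t ^ α) := by positivity
  refine summable_of_ratio_norm_eventually_le (r := 1 / 2) (by norm_num) ?_
  filter_upwards [h0.eventually (gt_mem_nhds hpos), hx.eventually_ge_atTop 1] with j hj hj1
  simp only [Function.comp] at hj
  set x := α * (j : ℝ) + β with hxdef
  have hx0 : 0 < x := by linarith
  have hG := Real.Gamma_pos_of_pos hx0
  have hG' : 0 < Real.Gamma (x + α) := Real.Gamma_pos_of_pos (by linarith)
  have e : α * ((j + 1 : ℕ) : ℝ) + β = x + α := by push_cast; ring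
  have hw := Gamma_add_le_mul_rpow (x := x + α) (s := 1 - α) (by linarith) (by linarith)
    (by linarith)
  rw [show x + α + (1 - α) = x + 1 by ring, Real.Gamma_add_one hx0.ne'] at hw
  have h2 : (x + α) ^ (1 - α) ≤ 2 * (x * x ^ (-α)) := by
    calc (x + α) ^ (1 - α) ≤ (2 * x) ^ (1 - α) :=
          Real.rpow_le_rpow (by linarith) (by linarith) (by linarith)
      _ = 2 ^ (1 - α) * (x * x ^ (-α)) := by
          rw [Real.mul_rpow (by norm_num) hx0.le, sub_eq_add_neg 1 α, Real.rpow_add hx0,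
            Real.rpow_one]
      _ ≤ 2 ^ (1 : ℝ) * (x * x ^ (-α)) := by
          gcongr
          · norm_num
          · linarith
      _ = _ := by rw [Real.rpow_one]
  have h3 : Real.Gamma x ≤ Real.Gamma (x + α) * (2 * x ^ (-α)) := by
    have : x * Real.Gamma x ≤ x * (Real.Gamma (x + α) * (2 * x ^ (-α))) := by
      calc _ ≤ _ := hw
        _ ≤ Real.Gamma (x + α) * (2 * (x * x ^ (-α))) := by gcongr
        _ = _ := by ring
    exact le_of_mul_le_mul_left this hx0
  have htα : 0 < t ^ α := by positivity
  have h4 : t ^ α * Real.Gamma x ≤ Real.Gamma (x + α) / 8 := by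
    have h5 : t ^ α * x ^ (-α) ≤ 1 / 16 := by
      rw [lt_div_iff₀ (by positivity)] at hj
      linarith
    calc t ^ α * Real.Gamma x ≤ t ^ α * (Real.Gamma (x + α) * (2 * x ^ (-α))) := by gcongr
      _ = 2 * Real.Gamma (x + α) * (t ^ α * x ^ (-α)) := by ring
      _ ≤ 2 * Real.Gamma (x + α) * (1 / 16) := by gcongr
      _ = _ := by ring
  have h6 : t ^ α / Real.Gamma (x + α) ≤ 1 / 8 * (1 / Real.Gamma x) := by
    rw [div_mul_div_comm, div_le_div_iff₀ hG' (by positivity)]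
    linarith
  rw [e, Real.norm_of_nonneg (by positivity), Real.norm_of_nonneg (by positivity),
    show α * ((j + 1 : ℕ) : ℝ) = α * j + α by push_cast; ring, Real.rpow_add ht]
  have hj0 : (0:ℝ) ≤ j := Nat.cast_nonneg j
  calc (((j + 1 : ℕ) : ℝ) + 1) ^ 2 * (t ^ (α * j) * t ^ α / Real.Gamma (x + α))
      = (((j + 1 : ℕ) : ℝ) + 1) ^ 2 * t ^ (α * (j : ℝ)) * (t ^ α / Real.Gamma (x + α)) := by ring
    _ ≤ (2 * ((j : ℝ) + 1)) ^ 2 * t ^ (α * (j : ℝ)) * (1 / 8 * (1 / Real.Gamma x)) := by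
        gcongr
        push_cast; linarith
    _ = _ := by ring

/-- The series `∑ c_j t ^ (αj + β - 1) / Γ(αj + β)`; for `c_j = (-1)^j` it is
`t ^ (β - 1)` times the Mittag-Leffler function `E_{α,β}(-t ^ α)`. -/
noncomputable def mlSeries (α β : ℝ) (c : ℕ → ℝ) (t : ℝ) : ℝ :=
  t ^ (β - 1) * ∑' j : ℕ, c j * (t ^ (α * j) / Real.Gamma (α * j + β))

variable {α β γ : ℝ} {c d : ℕ → ℝ}

lemma fracKernel_eq {t : ℝ} (ht : 0 < t) (j : ℕ) :
    fracKernel (α * j + β) t = t ^ (β - 1) * (t ^ (α * j) / Real.Gamma (α * j + β)) := by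
  rw [fracKernel, add_sub_assoc, Real.rpow_add ht]
  ring

lemma mul_add_pos (hα : 0 < α) (hβ : 0 < β) (j : ℕ) : 0 < α * j + β := by positivity

lemma hasSum_mlSeries (hα : 0 < α) (hα1 : α < 1) (hβ : 0 < β)
    (hc : ∀ j : ℕ, |c j| ≤ ((j : ℝ) + 1) ^ 2) {t : ℝ} (ht : 0 < t) :
    HasSum (fun j : ℕ => c j * fracKernel (α * j + β) t) (mlSeries α β c t) := by
  have h : Summable fun j : ℕ => c j * (t ^ (α * j) / Real.Gamma (α * j + β)) := by
    refine Summable.of_norm_bounded (summable_sq_mul_rpow_div_Gamma hα hα1 hβ ht) fun j => ?_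
    have := Real.Gamma_pos_of_pos (mul_add_pos hα hβ j)
    rw [norm_mul, Real.norm_eq_abs, Real.norm_of_nonneg (by positivity)]
    exact mul_le_mul_of_nonneg_right (hc j) (by positivity)
  refine (hasSum_congr fun j => ?_).2 (h.hasSum.mul_left (t ^ (β - 1)))
  rw [fracKernel_eq ht]
  ring

lemma continuousOn_mlSeries_aux (hα : 0 < α) (hα1 : α < 1) (hβ : 0 < β)
    (hc : ∀ j : ℕ, |c j| ≤ ((j : ℝ) + 1) ^ 2) :
    ContinuousOn (fun t : ℝ => ∑' j : ℕ, c j * (t ^ (α * j) / Real.Gamma (α * j + β))) (Ici 0) := by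
  intro x hx
  have hx : 0 ≤ x := hx
  have : ContinuousOn (fun t : ℝ => ∑' j : ℕ, c j * (t ^ (α * j) / Real.Gamma (α * j + β)))
      (Icc 0 (x + 1)) := by
    refine continuousOn_tsum (fun j => ?_)
      (summable_sq_mul_rpow_div_Gamma hα hα1 hβ (t := x + 1) (by linarith)) ?_
    · refine Continuous.continuousOn ?_
      exact continuous_const.mul ((Real.continuous_rpow_const (by positivity)).div_const _)
    · intro j s hs
      have := Real.Gamma_pos_of_pos (mul_add_pos hα hβ j)
      have h0 := hs.1
      rw [norm_mul, Real.norm_eq_abs, Real.norm_of_nonneg (by positivity)]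
      have h1 := Real.rpow_le_rpow h0 hs.2 (z := α * j) (by positivity)
      exact mul_le_mul (hc j) (by gcongr) (by positivity) (by positivity)
  refine (this x ⟨hx, by linarith⟩).mono_of_mem_nhdsWithin ?_
  rw [mem_nhdsWithin]
  exact ⟨Iio (x + 1), isOpen_Iio, by simp, fun y hy => ⟨hy.2, hy.1.le⟩⟩

lemma continuousOn_mlSeries (hα : 0 < α) (hα1 : α < 1) (hβ : 0 < β)
    (hc : ∀ j : ℕ, |c j| ≤ ((j : ℝ) + 1) ^ 2) : ContinuousOn (mlSeries α β c) (Ioi 0) := by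
  refine ContinuousOn.mul ?_ ((continuousOn_mlSeries_aux hα hα1 hβ hc).mono Ioi_subset_Ici_self)
  exact fun x hx => (Real.continuousAt_rpow_const _ _ (Or.inl hx.ne')).continuousWithinAt

lemma continuousOn_mlSeries_one (hα : 0 < α) (hα1 : α < 1)
    (hc : ∀ j : ℕ, |c j| ≤ ((j : ℝ) + 1) ^ 2) : ContinuousOn (mlSeries α 1 c) (Ici 0) := by
  have := continuousOn_mlSeries_aux hα hα1 one_pos hc
  unfold mlSeries
  simpa using this

lemma mlSeries_one_zero (hα : 0 < α) : mlSeries α 1 c 0 = c 0 := by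
  unfold mlSeries
  rw [tsum_eq_single 0]
  · simp
  · intro j hj
    rw [Real.zero_rpow (by positivity)]
    simp

/-- Termwise fractional integration of `mlSeries`. -/
lemma fracKernel_conv_mlSeries (hα : 0 < α) (hα1 : α < 1) (hβ : 0 < β) (hγ : 0 < γ)
    (hc : ∀ j : ℕ, |c j| ≤ ((j : ℝ) + 1) ^ 2) {t : ℝ} (ht : 0 < t) :
    IntervalIntegrable (fun s => fracKernel γ (t - s) * mlSeries α β c s) volume 0 t ∧
    ∫ s in 0..t, fracKernel γ (t - s) * mlSeries α β c s = mlSeries α (γ + β) c t := by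
  have hjp := mul_add_pos hα hβ
  have hterm := fun j : ℕ => fracKernel_conv hγ (hjp j) ht
  have hsum : Summable fun j : ℕ => |c j| * fracKernel (α * j + (γ + β)) t :=
    (hasSum_mlSeries hα hα1 (add_pos hγ hβ) (c := fun j => |c j|)
      (fun j => by rw [abs_abs]; exact hc j) ht).summable
  have hF_int : ∀ j : ℕ, Integrable
      (fun s => c j * (fracKernel γ (t - s) * fracKernel (α * j + β) s))
      (volume.restrict (Ioc 0 t)) := fun j =>
    ((intervalIntegrable_iff_integrableOn_Ioc_of_le ht.le).1 (hterm j).1).const_mul _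
  have hnn : ∀ (j : ℕ), ∀ s ∈ Ioc 0 t, 0 ≤ fracKernel γ (t - s) * fracKernel (α * j + β) s :=
    fun j s hs => mul_nonneg (fracKernel_nonneg hγ (by linarith [hs.2]))
      (fracKernel_nonneg (hjp j) hs.1.le)
  have hval : ∀ j : ℕ, ∫ s in Ioc 0 t, fracKernel γ (t - s) * fracKernel (α * j + β) s =
      fracKernel (α * j + (γ + β)) t := fun j => by
    rw [← intervalIntegral.integral_of_le ht.le, (hterm j).2]; congr 1; ring
  have hnorm : ∀ j : ℕ, ∫ s in Ioc 0 t,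
      ‖c j * (fracKernel γ (t - s) * fracKernel (α * j + β) s)‖ =
      |c j| * fracKernel (α * j + (γ + β)) t := fun j => by
    rw [← hval j, ← integral_const_mul]
    refine setIntegral_congr_fun measurableSet_Ioc fun s hs => ?_
    rw [norm_mul, Real.norm_eq_abs, Real.norm_of_nonneg (hnn j s hs)]
  have hmain := hasSum_integral_of_summable_integral_norm hF_int
    (by simp_rw [hnorm]; exact hsum)
  have hcongr : ∀ s ∈ Ioc 0 t,
      ∑' j : ℕ, c j * (fracKernel γ (t - s) * fracKernel (α * j + β) s) =
      fracKernel γ (t - s) * mlSeries α β c s := fun s hs => by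
    rw [← (hasSum_mlSeries hα hα1 hβ hc hs.1).tsum_eq, ← tsum_mul_left]
    exact tsum_congr fun j => by ring
  constructor
  · have hN := continuousOn_mlSeries_aux hα hα1 hβ hc
    obtain ⟨K, hK⟩ := (isCompact_Icc (a := (0:ℝ)) (b := t)).exists_bound_of_continuousOn
      (hN.mono Icc_subset_Ici_self)
    have hb : IntervalIntegrable (fun s => fracKernel γ (t - s) * fracKernel β s) volume 0 t :=
      (fracKernel_conv hγ hβ ht).1
    rw [intervalIntegrable_iff_integrableOn_Ioc_of_le ht.le] at hb ⊢
    refine (hb.mul_const (Real.Gamma β * K)).mono' ?_ ?_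
    · refine AEStronglyMeasurable.mul ?_ ?_
      · exact ((measurable_fracKernel γ).comp (by fun_prop)).aestronglyMeasurable
      · exact ((continuousOn_mlSeries hα hα1 hβ hc).mono Ioc_subset_Ioi_self).aestronglyMeasurable
          measurableSet_Ioc
    · filter_upwards [ae_restrict_mem measurableSet_Ioc] with s hs
      have h1 := fracKernel_nonneg hγ (t := t - s) (by linarith [hs.2])
      have hG := Real.Gamma_pos_of_pos hβ
      have h2 := Real.rpow_nonneg hs.1.le (β - 1)
      unfold mlSeries
      rw [norm_mul, norm_mul, Real.norm_of_nonneg h1, Real.norm_of_nonneg h2]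
      calc _ ≤ fracKernel γ (t - s) * (s ^ (β - 1) * K) := by
            gcongr
            exact hK s ⟨hs.1.le, hs.2⟩
        _ = _ := by rw [fracKernel.eq_def β]; field_simp
  · rw [intervalIntegral.integral_of_le ht.le, ← setIntegral_congr_fun measurableSet_Ioc hcongr]
    refine hmain.unique ?_
    refine (hasSum_congr fun j => ?_).2 (hasSum_mlSeries hα hα1 (add_pos hγ hβ) hc ht)
    rw [integral_const_mul, hval]

lemma integral_mlSeries (hα : 0 < α) (hα1 : α < 1) (hβ : 0 < β)
    (hc : ∀ j : ℕ, |c j| ≤ ((j : ℝ) + 1) ^ 2) {t : ℝ} (ht : 0 < t) :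
    IntervalIntegrable (mlSeries α β c) volume 0 t ∧
    ∫ s in 0..t, mlSeries α β c s = mlSeries α (β + 1) c t := by
  have := fracKernel_conv_mlSeries hα hα1 hβ one_pos hc ht
  simpa [fracKernel_one, add_comm] using this

/-- Removing the first term of the series. -/
lemma hasSum_mlSeries_shift (hα : 0 < α) (hα1 : α < 1) (hβ : 0 < β)
    (hc : ∀ j : ℕ, |c j| ≤ ((j : ℝ) + 1) ^ 2) {t : ℝ} (ht : 0 < t) :
    HasSum (fun j : ℕ => c (j + 1) * fracKernel (α * j + (β + α)) t)
      (mlSeries α β c t - c 0 * fracKernel β t) := by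
  have := (hasSum_nat_add_iff' 1).2 (hasSum_mlSeries hα hα1 hβ hc ht)
  simp only [Finset.sum_range_one, Nat.cast_zero, mul_zero, zero_add] at this
  refine (hasSum_congr fun j => ?_).2 this
  congr 2
  push_cast; ring

end Series

section MittagLeffler

variable {α : ℝ}

/-- The relaxation function `E_{α,1}(-t ^ α)`. -/
noncomputable def mlE (α : ℝ) : ℝ → ℝ := mlSeries α 1 fun j => (-1) ^ j

/-- Minus the derivative of `mlE α`. -/
noncomputable def mlP (α : ℝ) : ℝ → ℝ := mlSeries α α fun j => (-1) ^ j

/-- The function `t * mlP α t`. -/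
noncomputable def mlZ (α : ℝ) : ℝ → ℝ := mlSeries α 1 fun j => (-1) ^ (j + 1) * (α * j)

/-- The derivative of `mlZ α`. -/
noncomputable def mlDZ (α : ℝ) : ℝ → ℝ := mlSeries α α fun j => (-1) ^ j * (α * (j + 1))

/-- The function `t * mlDZ α t`. -/
noncomputable def mlZ₂ (α : ℝ) : ℝ → ℝ := mlSeries α 1 fun j => (-1) ^ (j + 1) * (α * j) ^ 2

lemma bound_mlE (j : ℕ) : |(-1 : ℝ) ^ j| ≤ ((j : ℝ) + 1) ^ 2 := by
  have : (0:ℝ) ≤ j := Nat.cast_nonneg j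
  simp only [abs_pow, abs_neg, abs_one, one_pow]
  nlinarith

lemma bound_mlZ (hα : 0 < α) (hα1 : α < 1) (j : ℕ) :
    |(-1 : ℝ) ^ (j + 1) * (α * j)| ≤ ((j : ℝ) + 1) ^ 2 := by
  have : (0:ℝ) ≤ j := Nat.cast_nonneg j
  simp only [abs_mul, abs_pow, abs_neg, abs_one, one_pow, one_mul, abs_of_nonneg this,
    abs_of_pos hα]
  nlinarith

lemma bound_mlDZ (hα : 0 < α) (hα1 : α < 1) (j : ℕ) :
    |(-1 : ℝ) ^ j * (α * (j + 1))| ≤ ((j : ℝ) + 1) ^ 2 := by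
  have : (0:ℝ) ≤ j := Nat.cast_nonneg j
  have h1 : (0:ℝ) ≤ j + 1 := by linarith
  simp only [abs_mul, abs_pow, abs_neg, abs_one, one_pow, one_mul, abs_of_nonneg h1,
    abs_of_pos hα]
  nlinarith

lemma bound_mlZ₂ (hα : 0 < α) (hα1 : α < 1) (j : ℕ) :
    |(-1 : ℝ) ^ (j + 1) * (α * j) ^ 2| ≤ ((j : ℝ) + 1) ^ 2 := by
  have : (0:ℝ) ≤ j := Nat.cast_nonneg j
  simp only [abs_mul, abs_pow, abs_neg, abs_one, one_pow, one_mul, abs_of_nonneg this,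
    abs_of_pos hα]
  gcongr
  nlinarith

lemma mul_fracKernel_add_one {x t : ℝ} (hx : 0 < x) (ht : 0 < t) :
    x * fracKernel (x + 1) t = t * fracKernel x t := by
  have := (Real.Gamma_pos_of_pos hx).ne'
  rw [fracKernel, fracKernel, Real.Gamma_add_one hx.ne', show x + 1 - 1 = x - 1 + 1 by ring,
    Real.rpow_add ht, Real.rpow_one]
  field_simp

lemma mlE_zero (hα : 0 < α) : mlE α 0 = 1 := by simp [mlE, mlSeries_one_zero hα]

lemma continuousOn_mlE (hα : 0 < α) (hα1 : α < 1) : ContinuousOn (mlE α) (Ici 0) :=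
  continuousOn_mlSeries_one hα hα1 bound_mlE

lemma continuousOn_mlZ (hα : 0 < α) (hα1 : α < 1) : ContinuousOn (mlZ α) (Ici 0) :=
  continuousOn_mlSeries_one hα hα1 (bound_mlZ hα hα1)

lemma continuousOn_mlZ₂ (hα : 0 < α) (hα1 : α < 1) : ContinuousOn (mlZ₂ α) (Ici 0) :=
  continuousOn_mlSeries_one hα hα1 (bound_mlZ₂ hα hα1)

lemma continuousOn_mlDZ (hα : 0 < α) (hα1 : α < 1) : ContinuousOn (mlDZ α) (Ioi 0) :=
  continuousOn_mlSeries hα hα1 hα (bound_mlDZ hα hα1)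

lemma hasSum_shift_mlE (hα : 0 < α) (hα1 : α < 1) {t : ℝ} (ht : 0 < t) :
    HasSum (fun j : ℕ => (-1 : ℝ) ^ (j + 1) * fracKernel (α * j + (1 + α)) t) (mlE α t - 1) := by
  simpa [fracKernel_one, mlE] using hasSum_mlSeries_shift hα hα1 one_pos bound_mlE ht

lemma hasSum_shift_mlZ (hα : 0 < α) (hα1 : α < 1) {t : ℝ} (ht : 0 < t) :
    HasSum (fun j : ℕ => (-1 : ℝ) ^ (j + 1 + 1) * (α * ((j + 1 : ℕ) : ℝ)) *
      fracKernel (α * j + (1 + α)) t) (mlZ α t) := by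
  simpa [fracKernel_one, mlZ] using hasSum_mlSeries_shift hα hα1 one_pos (bound_mlZ hα hα1) ht

lemma hasSum_shift_mlZ₂ (hα : 0 < α) (hα1 : α < 1) {t : ℝ} (ht : 0 < t) :
    HasSum (fun j : ℕ => (-1 : ℝ) ^ (j + 1 + 1) * (α * ((j + 1 : ℕ) : ℝ)) ^ 2 *
      fracKernel (α * j + (1 + α)) t) (mlZ₂ α t) := by
  simpa [fracKernel_one, mlZ₂] using hasSum_mlSeries_shift hα hα1 one_pos (bound_mlZ₂ hα hα1) ht

lemma mlSeries_alternating_eq (hα : 0 < α) (hα1 : α < 1) {t : ℝ} (ht : 0 < t) :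
    mlSeries α (α + 1) (fun j => (-1) ^ j) t = 1 - mlE α t := by
  refine (hasSum_mlSeries hα hα1 (by linarith) bound_mlE ht).unique ?_
  rw [← neg_sub]
  refine (hasSum_congr fun j => ?_).2 (hasSum_shift_mlE hα hα1 ht).neg
  rw [add_comm α 1]; ring

lemma conv_mlE (hα : 0 < α) (hα1 : α < 1) {t : ℝ} (ht : 0 < t) :
    IntervalIntegrable (fun s => fracKernel α (t - s) * mlE α s) volume 0 t ∧
    ∫ s in 0..t, fracKernel α (t - s) * mlE α s = 1 - mlE α t := by
  rw [← mlSeries_alternating_eq hα hα1 ht]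
  exact fracKernel_conv_mlSeries hα hα1 one_pos hα bound_mlE ht

lemma integral_mlP (hα : 0 < α) (hα1 : α < 1) {t : ℝ} (ht : 0 < t) :
    IntervalIntegrable (mlP α) volume 0 t ∧ ∫ s in 0..t, mlP α s = 1 - mlE α t := by
  rw [← mlSeries_alternating_eq hα hα1 ht]
  exact integral_mlSeries hα hα1 hα bound_mlE ht

lemma conv_mlP (hα : 0 < α) (hα1 : α < 1) {t : ℝ} (ht : 0 < t) :
    IntervalIntegrable (fun s => fracKernel (1 - α) (t - s) * mlP α s) volume 0 t ∧
    ∫ s in 0..t, fracKernel (1 - α) (t - s) * mlP α s = mlE α t := by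
  have := fracKernel_conv_mlSeries hα hα1 hα (sub_pos.2 hα1) bound_mlE ht
  rwa [sub_add_cancel] at this

lemma mul_mlP (hα : 0 < α) (hα1 : α < 1) {t : ℝ} (ht : 0 < t) : t * mlP α t = mlZ α t := by
  refine ((hasSum_mlSeries hα hα1 hα bound_mlE ht).mul_left t).unique ?_
  refine (hasSum_congr fun j => ?_).2 (hasSum_shift_mlZ hα hα1 ht)
  have := mul_fracKernel_add_one (mul_add_pos hα hα j) ht
  rw [show α * (j : ℝ) + (1 + α) = α * j + α + 1 by ring]
  push_cast
  linear_combination -(-1) ^ j * this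

lemma mul_mlDZ (hα : 0 < α) (hα1 : α < 1) {t : ℝ} (ht : 0 < t) : t * mlDZ α t = mlZ₂ α t := by
  refine ((hasSum_mlSeries hα hα1 hα (bound_mlDZ hα hα1) ht).mul_left t).unique ?_
  refine (hasSum_congr fun j => ?_).2 (hasSum_shift_mlZ₂ hα hα1 ht)
  have := mul_fracKernel_add_one (mul_add_pos hα hα j) ht
  rw [show α * (j : ℝ) + (1 + α) = α * j + α + 1 by ring]
  push_cast
  linear_combination -(-1) ^ j * (α * (j + 1)) * this

lemma integral_mlDZ (hα : 0 < α) (hα1 : α < 1) {t : ℝ} (ht : 0 < t) :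
    IntervalIntegrable (mlDZ α) volume 0 t ∧ ∫ s in 0..t, mlDZ α s = mlZ α t := by
  have h := integral_mlSeries hα hα1 hα (bound_mlDZ hα hα1) ht
  refine ⟨h.1, h.2.trans ?_⟩
  refine (hasSum_mlSeries hα hα1 (by linarith) (bound_mlDZ hα hα1) ht).unique ?_
  refine (hasSum_congr fun j => ?_).2 (hasSum_shift_mlZ hα hα1 ht)
  rw [add_comm α 1]
  push_cast; ring

lemma conv_mlZ (hα : 0 < α) (hα1 : α < 1) {t : ℝ} (ht : 0 < t) :
    IntervalIntegrable (fun s => fracKernel α (t - s) * mlZ α s) volume 0 t ∧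
    ∫ s in 0..t, fracKernel α (t - s) * mlZ α s = α * (1 - mlE α t) - mlZ α t := by
  have h := fracKernel_conv_mlSeries hα hα1 one_pos hα (bound_mlZ hα hα1) ht
  refine ⟨h.1, h.2.trans ?_⟩
  refine (hasSum_mlSeries hα hα1 (by linarith) (bound_mlZ hα hα1) ht).unique ?_
  rw [show α * (1 - mlE α t) - mlZ α t = -α * (mlE α t - 1) - mlZ α t by ring]
  refine (hasSum_congr fun j => ?_).2 (((hasSum_shift_mlE hα hα1 ht).mul_left (-α)).sub
    (hasSum_shift_mlZ hα hα1 ht))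
  rw [add_comm α 1]
  push_cast; ring

lemma conv_mlZ₂ (hα : 0 < α) (hα1 : α < 1) {t : ℝ} (ht : 0 < t) :
    IntervalIntegrable (fun s => fracKernel α (t - s) * mlZ₂ α s) volume 0 t ∧
    ∫ s in 0..t, fracKernel α (t - s) * mlZ₂ α s =
      2 * α * mlZ α t - α ^ 2 * (1 - mlE α t) - mlZ₂ α t := by
  have h := fracKernel_conv_mlSeries hα hα1 one_pos hα (bound_mlZ₂ hα hα1) ht
  refine ⟨h.1, h.2.trans ?_⟩
  refine (hasSum_mlSeries hα hα1 (by linarith) (bound_mlZ₂ hα hα1) ht).unique ?_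
  rw [show 2 * α * mlZ α t - α ^ 2 * (1 - mlE α t) - mlZ₂ α t =
    2 * α * mlZ α t + α ^ 2 * (mlE α t - 1) - mlZ₂ α t by ring]
  refine (hasSum_congr fun j => ?_).2 ((((hasSum_shift_mlZ hα hα1 ht).mul_left (2 * α)).add
    ((hasSum_shift_mlE hα hα1 ht).mul_left (α ^ 2))).sub (hasSum_shift_mlZ₂ hα hα1 ht))
  rw [add_comm α 1]
  push_cast; ring

end MittagLeffler

section Monotonicity

variable {α : ℝ}

lemma mlE_sub (hα : 0 < α) (hα1 : α < 1) {a b : ℝ} (ha : 0 ≤ a) (hb : 0 ≤ b) :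
    IntervalIntegrable (mlP α) volume a b ∧ ∫ s in a..b, mlP α s = mlE α a - mlE α b := by
  have h : ∀ x, 0 ≤ x → IntervalIntegrable (mlP α) volume 0 x ∧
      ∫ s in 0..x, mlP α s = 1 - mlE α x := by
    intro x hx
    rcases hx.eq_or_lt with rfl | hx
    · simp [mlE_zero hα]
    · exact integral_mlP hα hα1 hx
  obtain ⟨a1, a2⟩ := h a ha
  obtain ⟨b1, b2⟩ := h b hb
  refine ⟨a1.symm.trans b1, ?_⟩
  rw [← intervalIntegral.integral_interval_sub_left b1 a1, a2, b2]
  ring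

lemma eventually_mlP_pos (hα : 0 < α) (hα1 : α < 1) : ∀ᶠ t in 𝓝[>] (0:ℝ), 0 < mlP α t := by
  have h := (continuousOn_mlSeries_aux hα hα1 hα bound_mlE) 0 self_mem_Ici
  have h0 : 0 < ∑' j : ℕ, (-1 : ℝ) ^ j * ((0:ℝ) ^ (α * j) / Real.Gamma (α * j + α)) := by
    rw [tsum_eq_single 0]
    · simpa using Real.Gamma_pos_of_pos hα
    · intro j hj
      rw [Real.zero_rpow (by positivity)]
      simp
  have h1 := (h.mono Ioi_subset_Ici_self).eventually (lt_mem_nhds h0)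
  filter_upwards [h1, self_mem_nhdsWithin] with t ht ht0
  exact mul_pos (Real.rpow_pos_of_pos ht0 _) ht

lemma rpow_sub_le {α s t₀ t₁ : ℝ} (hα1 : α < 1) (hs : 0 ≤ s) (hst : s < t₁)
    (h : t₁ ≤ t₀) : (t₀ - s) ^ (α - 1) ≤ (t₀ / t₁) ^ (α - 1) * (t₁ - s) ^ (α - 1) := by
  have ht₁ : 0 < t₁ := by linarith
  have ht₀ : 0 < t₀ := by linarith
  rw [← Real.mul_rpow (by positivity) (by linarith)]
  refine Real.rpow_le_rpow_of_nonpos (by have : 0 < t₁ - s := by linarith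
                                         positivity) ?_ (by linarith)
  rw [div_mul_eq_mul_div, div_le_iff₀ ht₁]
  nlinarith

/-- The derivative of the relaxation function is negative: a first zero of `mlZ` is excluded
by comparing the Volterra equation at two nearby times. -/
lemma mlZ_pos (hα : 0 < α) (hα1 : α < 1) {t : ℝ} (ht : 0 < t) : 0 < mlZ α t := by
  by_contra! hneg
  have hcont := continuousOn_mlZ hα hα1
  set S := {s : ℝ | 0 < s ∧ mlZ α s ≤ 0} with hS
  have hSne : S.Nonempty := ⟨t, ht, hneg⟩
  have hSbdd : BddBelow S := ⟨0, fun s hs => hs.1.le⟩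
  obtain ⟨ε, hε, hεpos⟩ : ∃ ε > 0, ∀ s ∈ Ioo 0 ε, 0 < mlP α s := by
    have := eventually_mlP_pos hα hα1
    rw [eventually_nhdsWithin_iff, Metric.eventually_nhds_iff] at this
    obtain ⟨ε, hε, h⟩ := this
    exact ⟨ε, hε, fun s hs => h (by simpa [abs_of_pos hs.1] using hs.2) hs.1⟩
  set t₀ := sInf S with ht₀
  have ht₀pos : 0 < t₀ := by
    refine lt_of_lt_of_le hε (le_csInf hSne fun s hs => ?_)
    by_contra! h
    have := mul_pos hs.1 (hεpos s ⟨hs.1, h⟩)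
    rw [mul_mlP hα hα1 hs.1] at this
    linarith [hs.2]
  have hpos : ∀ s, 0 < s → s < t₀ → 0 < mlZ α s := by
    intro s hs hst
    by_contra! h
    exact (not_lt.2 (csInf_le hSbdd ⟨hs, h⟩)) hst
  have hP : ∀ s, 0 < s → s < t₀ → 0 < mlP α s := by
    intro s hs hst
    have := hpos s hs hst
    rw [← mul_mlP hα hα1 hs] at this
    exact pos_of_mul_pos_right this hs.le
  have hz₀ : mlZ α t₀ ≤ 0 := by
    have hmem : t₀ ∈ closure S := csInf_mem_closure hSne hSbdd
    have hc : ContinuousAt (mlZ α) t₀ := hcont.continuousAt (Ici_mem_nhds ht₀pos)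
    by_contra! h
    obtain ⟨s, hs1, hs2⟩ := mem_closure_iff_nhds.1 hmem _ (hc.eventually (lt_mem_nhds h))
    exact absurd hs2.2 (not_le.2 hs1)
  obtain ⟨δ, hδ, hδt, hδsmall⟩ : ∃ δ > 0, δ < t₀ / 2 ∧ δ ^ α / Real.Gamma (α + 1) < 1 / 2 := by
    have : Tendsto (fun δ : ℝ => δ ^ α / Real.Gamma (α + 1)) (𝓝[>] 0) (𝓝 0) := by
      have : Continuous fun δ : ℝ => δ ^ α / Real.Gamma (α + 1) :=
        (Real.continuous_rpow_const hα.le).div_const _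
      have := this.tendsto 0
      rw [Real.zero_rpow hα.ne', zero_div] at this
      exact this.mono_left nhdsWithin_le_nhds
    have h2 := this.eventually (gt_mem_nhds (by norm_num : (0:ℝ) < 1 / 2))
    have h3 : ∀ᶠ δ in 𝓝[>] (0:ℝ), δ < t₀ / 2 :=
      nhdsWithin_le_nhds (gt_mem_nhds (by linarith))
    obtain ⟨δ, h⟩ := (h2.and (h3.and self_mem_nhdsWithin)).exists
    exact ⟨δ, h.2.2, h.2.1, h.1⟩
  obtain ⟨t₁, ht₁, hmax⟩ := (isCompact_Icc (a := t₀ - δ) (b := t₀)).exists_isMaxOn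
    (nonempty_Icc.2 (by linarith)) (hcont.mono fun s hs => by
      have := hs.1; simp only [mem_Ici]; linarith)
  have hmax' : ∀ s ∈ Icc (t₀ - δ) t₀, mlZ α s ≤ mlZ α t₁ := hmax
  have hz₁ : 0 < mlZ α t₁ :=
    (hpos (t₀ - δ) (by linarith) (by linarith)).trans_le (hmax' _ ⟨le_rfl, by linarith⟩)
  have ht₁₀ : t₁ < t₀ := lt_of_le_of_ne ht₁.2 (by rintro h; rw [h] at hz₁; linarith)
  have ht₁pos : t₀ / 2 < t₁ := by linarith [ht₁.1]
  have ht₁p : 0 < t₁ := by linarith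
  obtain ⟨i₀, e₀⟩ := conv_mlZ hα hα1 ht₀pos
  obtain ⟨i₁, e₁⟩ := conv_mlZ hα hα1 ht₁p
  have hG := Real.Gamma_pos_of_pos hα
  set ρ := (t₀ / t₁) ^ (α - 1) with hρ
  have hρ1 : ρ ≤ 1 := Real.rpow_le_one_of_one_le_of_nonpos
    ((one_le_div ht₁p).2 ht₁₀.le) (by linarith)
  have hρ2 : 1 / 2 ≤ ρ := by
    calc (1 / 2 : ℝ) = 2 ^ (-1 : ℝ) := by rw [Real.rpow_neg_one]; norm_num
      _ ≤ 2 ^ (α - 1) := Real.rpow_le_rpow_of_exponent_le (by norm_num) (by linarith)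
      _ ≤ ρ := Real.rpow_le_rpow_of_nonpos (by positivity)
          (by rw [div_le_iff₀ ht₁p]; linarith) (by linarith)
  have iA : IntervalIntegrable (fun s => fracKernel α (t₀ - s) * mlZ α s) volume 0 t₁ :=
    i₀.mono_set (by
      rw [uIcc_of_le ht₁p.le, uIcc_of_le ht₀pos.le]
      exact Icc_subset_Icc_right ht₁₀.le)
  have iB : IntervalIntegrable (fun s => fracKernel α (t₀ - s) * mlZ α s) volume t₁ t₀ :=
    i₀.mono_set (by
      rw [uIcc_of_le ht₁₀.le, uIcc_of_le ht₀pos.le]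
      exact Icc_subset_Icc_left ht₁p.le)
  have hA : ∫ s in 0..t₁, fracKernel α (t₀ - s) * mlZ α s ≤
      ρ * (α * (1 - mlE α t₁) - mlZ α t₁) := by
    rw [← e₁, ← intervalIntegral.integral_const_mul]
    refine intervalIntegral.integral_mono_on_of_le_Ioo ht₁p.le iA (i₁.const_mul _) fun s hs => ?_
    rw [← mul_assoc]
    refine mul_le_mul_of_nonneg_right ?_ (hpos s hs.1 (hs.2.trans ht₁₀)).le
    unfold fracKernel
    rw [mul_div_assoc']
    gcongr
    exact rpow_sub_le hα1 hs.1.le hs.2 ht₁₀.le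
  have hB : ∫ s in t₁..t₀, fracKernel α (t₀ - s) * mlZ α s < mlZ α t₁ * (1 / 2) := by
    have hk : IntervalIntegrable (fun s => fracKernel α (t₀ - s)) volume t₁ t₀ := by
      have := (intervalIntegrable_fracKernel hα 0 (t₀ - t₁)).comp_sub_left t₀
      simpa using this.symm
    calc _ ≤ ∫ s in t₁..t₀, fracKernel α (t₀ - s) * mlZ α t₁ := by
          refine intervalIntegral.integral_mono_on_of_le_Ioo ht₁₀.le iB (hk.mul_const _)
            fun s hs => ?_
          exact mul_le_mul_of_nonneg_left (hmax' s ⟨by linarith [ht₁.1, hs.1], hs.2.le⟩)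
            (fracKernel_nonneg hα (by linarith [hs.2]))
      _ = mlZ α t₁ * ((t₀ - t₁) ^ α / Real.Gamma (α + 1)) := by
          rw [intervalIntegral.integral_mul_const,
            intervalIntegral.integral_comp_sub_left (fun s => fracKernel α s) t₀,
            sub_self, integral_fracKernel hα, Real.zero_rpow hα.ne', sub_zero, mul_comm]
      _ ≤ mlZ α t₁ * (δ ^ α / Real.Gamma (α + 1)) := by
          have := Real.Gamma_pos_of_pos (show 0 < α + 1 by linarith)
          have : 0 ≤ t₀ - t₁ := by linarith
          gcongr
          linarith [ht₁.1]
      _ < _ := mul_lt_mul_of_pos_left hδsmall hz₁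
  have hE : mlE α t₀ ≤ mlE α t₁ := by
    have h := mlE_sub hα hα1 ht₁p.le ht₀pos.le
    have := intervalIntegral.integral_mono_on_of_le_Ioo ht₁₀.le intervalIntegrable_const h.1
      fun s hs => (hP s (ht₁p.trans hs.1) hs.2).le
    simp only [intervalIntegral.integral_zero] at this
    linarith [h.2]
  have hE1 : mlE α t₁ ≤ 1 := by
    have h := integral_mlP hα hα1 ht₁p
    have := intervalIntegral.integral_mono_on_of_le_Ioo ht₁p.le intervalIntegrable_const h.1
      fun s hs => (hP s hs.1 (hs.2.trans ht₁₀)).le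
    simp only [intervalIntegral.integral_zero] at this
    linarith [h.2]
  rw [← intervalIntegral.integral_add_adjacent_intervals iA iB] at e₀
  have h1 : ρ * (α * (1 - mlE α t₁)) ≤ α * (1 - mlE α t₁) :=
    mul_le_of_le_one_left (mul_nonneg hα.le (by linarith)) hρ1
  have h2 : mlZ α t₁ * (1 / 2) ≤ ρ * mlZ α t₁ := by nlinarith
  have h3 : α * mlE α t₀ ≤ α * mlE α t₁ := by gcongr
  linarith

lemma mlP_pos (hα : 0 < α) (hα1 : α < 1) {t : ℝ} (ht : 0 < t) : 0 < mlP α t := by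
  have := mlZ_pos hα hα1 ht
  rw [← mul_mlP hα hα1 ht] at this
  exact pos_of_mul_pos_right this ht.le

lemma antitoneOn_mlE (hα : 0 < α) (hα1 : α < 1) : AntitoneOn (mlE α) (Ici 0) := by
  intro a ha b hb hab
  have h := mlE_sub hα hα1 ha hb
  have := intervalIntegral.integral_mono_on_of_le_Ioo hab intervalIntegrable_const h.1
    fun s hs => (mlP_pos hα hα1 (lt_of_le_of_lt ha hs.1)).le
  simp only [intervalIntegral.integral_zero] at this
  linarith [h.2]

lemma mlE_le_one (hα : 0 < α) (hα1 : α < 1) {t : ℝ} (ht : 0 ≤ t) : mlE α t ≤ 1 := by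
  have := antitoneOn_mlE hα hα1 self_mem_Ici ht ht
  rwa [mlE_zero hα] at this

lemma mlE_nonneg (hα : 0 < α) (hα1 : α < 1) {t : ℝ} (ht : 0 ≤ t) : 0 ≤ mlE α t := by
  rcases ht.eq_or_lt with rfl | ht
  · simp [mlE_zero hα]
  have h := conv_mlP hα hα1 ht
  have := intervalIntegral.integral_mono_on_of_le_Ioo ht.le intervalIntegrable_const h.1
    fun s hs => mul_nonneg (fracKernel_nonneg (sub_pos.2 hα1) (sub_nonneg.2 hs.2.le))
      (mlP_pos hα hα1 hs.1).le
  simp only [intervalIntegral.integral_zero] at this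
  linarith [h.2]

lemma one_sub_mlE_le (hα : 0 < α) (hα1 : α < 1) {t : ℝ} (ht : 0 ≤ t) :
    1 - mlE α t ≤ t ^ α / Real.Gamma (α + 1) := by
  rcases ht.eq_or_lt with rfl | ht
  · simp [mlE_zero hα, Real.zero_rpow hα.ne']
  have h := conv_mlE hα hα1 ht
  have hk : IntervalIntegrable (fun s => fracKernel α (t - s)) volume 0 t := by
    simpa using ((intervalIntegrable_fracKernel hα 0 t).comp_sub_left t).symm
  have := intervalIntegral.integral_mono_on_of_le_Ioo ht.le h.1 hk fun s hs =>
    mul_le_of_le_one_right (fracKernel_nonneg hα (sub_nonneg.2 hs.2.le))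
      (mlE_le_one hα hα1 hs.1.le)
  rw [h.2, intervalIntegral.integral_comp_sub_left (fun s => fracKernel α s) t,
    sub_self, sub_zero, integral_fracKernel hα, Real.zero_rpow hα.ne', sub_zero] at this
  exact this

lemma mlE_mul_le (hα : 0 < α) (hα1 : α < 1) {t : ℝ} (ht : 0 ≤ t) :
    mlE α t * (t ^ α / Real.Gamma (α + 1)) ≤ 1 := by
  rcases ht.eq_or_lt with rfl | ht
  · simp [mlE_zero hα, Real.zero_rpow hα.ne']
  have h := conv_mlE hα hα1 ht
  have hk : IntervalIntegrable (fun s => fracKernel α (t - s)) volume 0 t := by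
    simpa using ((intervalIntegrable_fracKernel hα 0 t).comp_sub_left t).symm
  have := intervalIntegral.integral_mono_on_of_le_Ioo ht.le (hk.mul_const (mlE α t)) h.1
    fun s hs => mul_le_mul_of_nonneg_left (antitoneOn_mlE hα hα1 hs.1.le ht.le hs.2.le)
      (fracKernel_nonneg hα (sub_nonneg.2 hs.2.le))
  rw [h.2, intervalIntegral.integral_mul_const,
    intervalIntegral.integral_comp_sub_left (fun s => fracKernel α s) t,
    sub_self, sub_zero, integral_fracKernel hα, Real.zero_rpow hα.ne', sub_zero] at this
  linarith [mlE_nonneg hα hα1 ht.le]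

end Monotonicity

section Volterra

variable {α : ℝ}

lemma continuousOn_fracKernel (γ : ℝ) : ContinuousOn (fracKernel γ) (Ioi 0) := fun _ hx =>
  ((Real.continuousAt_rpow_const _ _ (Or.inl (ne_of_gt hx))).div_const _).continuousWithinAt

lemma conv_mlE_comm (hα : 0 < α) (hα1 : α < 1) {t : ℝ} (ht : 0 < t) :
    IntervalIntegrable (fun s => mlE α (t - s) * fracKernel α s) volume 0 t ∧
    ∫ s in 0..t, mlE α (t - s) * fracKernel α s = 1 - mlE α t := by
  obtain ⟨h1, h2⟩ := conv_mlE hα hα1 ht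
  constructor
  · have := (h1.comp_sub_left t).symm
    simpa [mul_comm] using this
  · rw [← h2]
    have := intervalIntegral.integral_comp_sub_left
      (a := 0) (b := t) (fun s => fracKernel α (t - s) * mlE α s) t
    simp only [sub_self, sub_zero, sub_sub_cancel] at this
    rw [← this]
    simp only [mul_comm]

section resolvent

variable {F : Type*} [NormedAddCommGroup F] [NormedSpace ℝ F] {w g : ℝ → F}

lemma continuousOn_mlE_sub (hα : 0 < α) (hα1 : α < 1) (t : ℝ) :
    ContinuousOn (fun s => mlE α (t - s)) (Iic t) :=
  (continuousOn_mlE hα hα1).comp (by fun_prop) fun s hs => by simpa using hs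

lemma intervalIntegrable_mlE_smul (hα : 0 < α) (hα1 : α < 1) {a b t : ℝ} (ha : 0 ≤ a)
    (hb : 0 ≤ b) (hat : a ≤ t) (hbt : b ≤ t) (hg : ContinuousOn g (Ici 0)) :
    IntervalIntegrable (fun s => mlE α (t - s) • g s) volume a b := by
  refine ContinuousOn.intervalIntegrable (ContinuousOn.smul
    ((continuousOn_mlE_sub hα hα1 t).mono ?_) (hg.mono ?_))
  · exact fun s hs => hs.2.trans (max_le hat hbt)
  · exact fun s hs => (le_min ha hb).trans hs.1

variable [CompleteSpace F]

/-- Solution of a Volterra equation with weakly singular kernel by means of the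
relaxation function. -/
lemma integral_eq_of_volterra (hα : 0 < α) (hα1 : α < 1) (hw : ContinuousOn w (Ici 0))
    (hg : ContinuousOn g (Ici 0))
    (h : ∀ t, 0 < t → w t + ∫ s in 0..t, fracKernel α (t - s) • w s = g t)
    {t : ℝ} (ht : 0 ≤ t) :
    ∫ s in 0..t, w s = ∫ s in 0..t, mlE α (t - s) • g s := by
  rcases ht.eq_or_lt with rfl | ht
  · simp
  have hIoo : Ioo 0 t ⊆ Ici 0 := fun s hs => hs.1.le
  have hcE : ContinuousOn (fun s => (1 - mlE α (t - s)) * ‖w s‖) (Icc 0 t) :=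
    (continuousOn_const.sub ((continuousOn_mlE_sub hα hα1 t).mono Icc_subset_Iic_self)).mul
      (hw.mono Icc_subset_Ici_self).norm
  have key := conv_assoc (f := mlE α) (g := fracKernel α) (h := w) (Q := fun x => 1 - mlE α x) ht
    ((continuousOn_mlE hα hα1).mono Ioi_subset_Ici_self)
    (continuousOn_fracKernel α)
    ((hw.mono hIoo).aestronglyMeasurable measurableSet_Ioo)
    (fun x hx => mlE_nonneg hα hα1 hx.le) (fun x hx => fracKernel_nonneg hα hx.le)
    (fun x hx => conv_mlE_comm hα hα1 hx)
    (hcE.integrableOn_Icc.mono_set Ioo_subset_Icc_self)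
  have e1 : ∫ s in 0..t, mlE α (t - s) • ∫ r in 0..s, fracKernel α (s - r) • w r =
      ∫ s in 0..t, (mlE α (t - s) • g s - mlE α (t - s) • w s) := by
    refine intervalIntegral.integral_congr_ae (.of_forall fun s hs => ?_)
    rw [uIoc_of_le ht.le] at hs
    rw [← smul_sub, ← h s hs.1, add_sub_cancel_left]
  have iE := fun {g : ℝ → F} (hg : ContinuousOn g (Ici 0)) =>
    intervalIntegrable_mlE_smul hα hα1 le_rfl ht.le ht.le le_rfl hg
  have iw : IntervalIntegrable w volume 0 t :=
    (hw.mono (by rw [uIcc_of_le ht.le]; exact Icc_subset_Ici_self)).intervalIntegrable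
  rw [e1, intervalIntegral.integral_sub (iE hg) (iE hw)] at key
  simp only [sub_smul, one_smul] at key
  rw [intervalIntegral.integral_sub iw (iE hw)] at key
  exact (sub_left_injective key).symm

lemma intervalIntegrable_mlE (hα : 0 < α) (hα1 : α < 1) {a b : ℝ} (ha : 0 ≤ a) (hb : 0 ≤ b) :
    IntervalIntegrable (mlE α) volume a b :=
  ((continuousOn_mlE hα hα1).mono fun _ hs => (le_min ha hb).trans hs.1).intervalIntegrable

lemma norm_le_of_volterra (hα : 0 < α) (hα1 : α < 1) (hw : ContinuousOn w (Ici 0))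
    (hg : ContinuousOn g (Ici 0))
    (h : ∀ t, 0 < t → w t + ∫ s in 0..t, fracKernel α (t - s) • w s = g t)
    {T G : ℝ} (hG : ∀ s ∈ Ioo 0 T, ‖g s‖ ≤ G) {t : ℝ} (ht : t ∈ Ioo 0 T) :
    ‖w t‖ ≤ 2 * G := by
  have hG0 : 0 ≤ G := (norm_nonneg _).trans (hG t ht)
  have lip : ∀ a b, 0 < a → a ≤ b → b < T →
      ‖(∫ s in 0..b, w s) - ∫ s in 0..a, w s‖ ≤ 2 * G * (b - a) := by
    intro a b ha hab hb
    have hb0 : 0 < b := ha.trans_le hab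
    rw [integral_eq_of_volterra hα hα1 hw hg h hb0.le, integral_eq_of_volterra hα hα1 hw hg h ha.le,
      ← intervalIntegral.integral_add_adjacent_intervals
        (intervalIntegrable_mlE_smul hα hα1 le_rfl ha.le hb0.le hab hg)
        (intervalIntegrable_mlE_smul hα hα1 ha.le hb0.le hab le_rfl hg),
      add_sub_right_comm, ← intervalIntegral.integral_sub
        (intervalIntegrable_mlE_smul hα hα1 le_rfl ha.le hb0.le hab hg)
        (intervalIntegrable_mlE_smul hα hα1 le_rfl ha.le ha.le le_rfl hg)]
    have i1 : IntervalIntegrable (fun s => mlE α (a - s)) volume 0 a := by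
      simpa using ((intervalIntegrable_mlE hα hα1 le_rfl ha.le).comp_sub_left a).symm
    have i2 : IntervalIntegrable (fun s => mlE α (b - s)) volume 0 a := by
      simpa using ((intervalIntegrable_mlE hα hα1 (a := b - a) (b := b)
        (by linarith) hb0.le).comp_sub_left b).symm
    have b1 : ‖∫ s in 0..a, (mlE α (b - s) • g s - mlE α (a - s) • g s)‖ ≤
        ∫ s in 0..a, (mlE α (a - s) - mlE α (b - s)) * G := by
      refine intervalIntegral.norm_integral_le_of_norm_le ha.le
        ((ae_restrict_iff' measurableSet_Ioc).1 ?_) ((i1.sub i2).mul_const _)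
      rw [← restrict_Ioo_eq_restrict_Ioc]
      refine (ae_restrict_iff' measurableSet_Ioo).2 (.of_forall fun s hs => ?_)
      have hE := antitoneOn_mlE hα hα1 (sub_nonneg.2 hs.2.le) (b := b - s)
        (by simp only [mem_Ici]; linarith [hs.2]) (by linarith)
      rw [← sub_smul, norm_smul, Real.norm_eq_abs, abs_sub_comm, abs_of_nonneg (sub_nonneg.2 hE)]
      exact mul_le_mul_of_nonneg_left (hG s ⟨hs.1, by linarith [hs.2]⟩) (sub_nonneg.2 hE)
    have b2 : ‖∫ s in a..b, mlE α (b - s) • g s‖ ≤ G * |b - a| := by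
      refine intervalIntegral.norm_integral_le_of_norm_le_const fun s hs => ?_
      rw [uIoc_of_le hab] at hs
      have hbs : 0 ≤ b - s := sub_nonneg.2 hs.2
      rw [norm_smul, Real.norm_eq_abs, abs_of_nonneg (mlE_nonneg hα hα1 hbs)]
      exact (mul_le_of_le_one_left (norm_nonneg _) (mlE_le_one hα hα1 hbs)).trans
        (hG s ⟨ha.trans hs.1, hs.2.trans_lt hb⟩)
    have b3 : ∫ s in 0..a, (mlE α (a - s) - mlE α (b - s)) ≤ b - a := by
      rw [intervalIntegral.integral_sub i1 i2, intervalIntegral.integral_comp_sub_left,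
        intervalIntegral.integral_comp_sub_left, sub_self, sub_zero, sub_zero]
      have ii := fun {x y : ℝ} => intervalIntegrable_mlE hα hα1 (a := x) (b := y)
      have j1 := intervalIntegral.integral_add_adjacent_intervals
        (ii le_rfl ha.le) (ii ha.le hb0.le)
      have j2 := intervalIntegral.integral_add_adjacent_intervals
        (ii le_rfl (sub_nonneg.2 hab)) (ii (sub_nonneg.2 hab) hb0.le)
      have j3 := intervalIntegral.integral_mono_on hab intervalIntegrable_const
        (ii ha.le hb0.le) fun s hs => mlE_nonneg hα hα1 (ha.le.trans hs.1)
      have j4 := intervalIntegral.integral_mono_on (sub_nonneg.2 hab)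
        (ii le_rfl (sub_nonneg.2 hab)) intervalIntegrable_const fun s hs =>
        mlE_le_one hα hα1 hs.1
      simp only [intervalIntegral.integral_const, smul_eq_mul, mul_zero, mul_one] at j3 j4
      linarith
    rw [intervalIntegral.integral_mul_const] at b1
    rw [abs_of_nonneg (sub_nonneg.2 hab)] at b2
    refine (norm_add_le _ _).trans ((add_le_add b1 b2).trans ?_)
    nlinarith
  have hd : HasDerivAt (fun x => ∫ s in 0..x, w s) (w t) t := by
    have hn : Ioi 0 ∈ 𝓝 t := Ioi_mem_nhds ht.1
    refine intervalIntegral.integral_hasDerivAt_right ?_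
      ((hw.mono Ioi_subset_Ici_self).stronglyMeasurableAtFilter isOpen_Ioi t ht.1)
      (hw.continuousAt (Ici_mem_nhds ht.1))
    exact (hw.mono (by rw [uIcc_of_le ht.1.le]; exact Icc_subset_Ici_self)).intervalIntegrable
  refine hd.le_of_lip' (by positivity) ?_
  filter_upwards [Ioo_mem_nhds ht.1 ht.2] with x hx
  rcases le_total t x with htx | htx
  · rw [Real.norm_eq_abs, abs_of_nonneg (sub_nonneg.2 htx)]
    exact lip t x ht.1 htx hx.2
  · rw [Real.norm_eq_abs, abs_sub_comm, abs_of_nonneg (sub_nonneg.2 htx), norm_sub_rev]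
    exact lip x t hx.1 htx ht.2

end resolvent

end Volterra

section Bounds

variable {α : ℝ}

lemma min_rpow_two_mul_le (hα1 : α < 1) {t : ℝ} (ht : 0 < t) :
    min 1 ((2 * t) ^ α) ≤ 2 * min 1 (t ^ α) := by
  rw [Real.mul_rpow (by norm_num) ht.le]
  have h2 : (2:ℝ) ^ α ≤ 2 := by
    simpa using Real.rpow_le_rpow_of_exponent_le (x := 2) (by norm_num) hα1.le
  have : 0 < t ^ α := Real.rpow_pos_of_pos ht _
  rw [mul_min_of_nonneg _ _ (by norm_num)]
  exact min_le_min (by norm_num) (by gcongr)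

lemma min_rpow_mono (hα : 0 < α) {s t : ℝ} (hs : 0 ≤ s) (hst : s ≤ t) :
    min 1 (s ^ α) ≤ min 1 (t ^ α) :=
  min_le_min le_rfl (Real.rpow_le_rpow hs hst hα.le)

lemma exists_mlZ_bound (hα : 0 < α) (hα1 : α < 1) : ∃ K, 0 < K ∧ ∀ t, 0 < t →
    1 - mlE α t ≤ K * min 1 (t ^ α) ∧ mlZ α t ≤ K * min 1 (t ^ α) ∧
      |mlZ₂ α t| ≤ K * min 1 (t ^ α) := by
  have hΓ : 0 < Real.Gamma (α + 1) := Real.Gamma_pos_of_pos (by linarith)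
  set K := 1 + 1 / Real.Gamma (α + 1) with hK
  have hK0 : 0 < K := by positivity
  have hM : ∀ t : ℝ, 0 < t → 0 < min 1 (t ^ α) := fun t ht =>
    lt_min one_pos (Real.rpow_pos_of_pos ht _)
  have b0 : ∀ t, 0 < t → 1 - mlE α t ≤ K * min 1 (t ^ α) := by
    intro t ht
    have h1 := mlE_nonneg hα hα1 ht.le
    have h2 := one_sub_mlE_le hα hα1 ht.le
    have h3 := Real.rpow_pos_of_pos ht α
    rw [mul_min_of_nonneg _ _ hK0.le]
    refine le_min ?_ (h2.trans ?_)
    · have : 0 < 1 / Real.Gamma (α + 1) := by positivity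
      linarith
    · rw [hK, add_mul, one_div_mul_eq_div]
      linarith
  have bq : ∀ t s, s ∈ Ioo 0 (2 * t) → 1 - mlE α s ≤ 2 * K * min 1 (t ^ α) := by
    intro t s hs
    have ht : 0 < t := by linarith [hs.1, hs.2]
    refine (b0 s hs.1).trans ?_
    have := (min_rpow_mono hα hs.1.le hs.2.le).trans (min_rpow_two_mul_le hα1 ht)
    nlinarith
  have ci : ∀ {a b : ℝ}, ContinuousOn (fun t => a * mlZ α t + b * (1 - mlE α t)) (Ici 0) :=
    fun {a b} => (continuousOn_const.mul (continuousOn_mlZ hα hα1)).add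
      (continuousOn_const.mul (continuousOn_const.sub (continuousOn_mlE hα hα1)))
  have b1 : ∀ t, 0 < t → mlZ α t ≤ 4 * K * min 1 (t ^ α) := by
    intro t ht
    have h := norm_le_of_volterra hα hα1 (continuousOn_mlZ hα hα1) (ci (a := 0) (b := α))
      (fun t ht => by
        simp only [smul_eq_mul]
        rw [(conv_mlZ hα hα1 ht).2]; ring) (T := 2 * t) (G := 2 * K * min 1 (t ^ α))
      (fun s hs => by
        have h1 := bq t s hs
        have h2 := mlE_le_one hα hα1 hs.1.le
        rw [Real.norm_eq_abs, zero_mul, zero_add, abs_of_nonneg (by nlinarith)]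
        nlinarith) ⟨ht, by linarith⟩
    exact (le_abs_self _).trans (h.trans (by linarith))
  have b2 : ∀ t, 0 < t → |mlZ₂ α t| ≤ 36 * K * min 1 (t ^ α) := by
    intro t ht
    have h := norm_le_of_volterra hα hα1 (continuousOn_mlZ₂ hα hα1)
      (ci (a := 2 * α) (b := -α ^ 2))
      (fun t ht => by
        simp only [smul_eq_mul]
        rw [(conv_mlZ₂ hα hα1 ht).2]; ring) (T := 2 * t) (G := 18 * K * min 1 (t ^ α))
      (fun s hs => by
        have h1 := bq t s hs
        have h2 := mlE_le_one hα hα1 hs.1.le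
        have h3 := b1 s hs.1
        have h4 := mlZ_pos hα hα1 hs.1
        have h5 := (min_rpow_mono hα hs.1.le hs.2.le).trans (min_rpow_two_mul_le hα1 ht)
        have h6 : 4 * K * min 1 (s ^ α) ≤ 8 * K * min 1 (t ^ α) := by nlinarith
        have h7 : 0 ≤ α * mlZ α s := by positivity
        have h8 : α * mlZ α s ≤ mlZ α s := by nlinarith
        have h9 : 0 ≤ α ^ 2 * (1 - mlE α s) := mul_nonneg (by positivity) (by linarith)
        have h10 : α ^ 2 * (1 - mlE α s) ≤ 1 - mlE α s :=
          mul_le_of_le_one_left (by linarith) (by nlinarith)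
        rw [Real.norm_eq_abs, abs_le]
        constructor <;> nlinarith) ⟨ht, by linarith⟩
    exact h.trans (by linarith)
  refine ⟨36 * K, by positivity, fun t ht => ⟨(b0 t ht).trans ?_, (b1 t ht).trans ?_, b2 t ht⟩⟩ <;>
  · have := mul_pos hK0 (hM t ht)
    linarith

lemma hasDerivAt_mlZ (hα : 0 < α) (hα1 : α < 1) {t : ℝ} (ht : 0 < t) :
    HasDerivAt (mlZ α) (mlDZ α t) t := by
  have hc := continuousOn_mlDZ hα hα1
  have := intervalIntegral.integral_hasDerivAt_right (integral_mlDZ hα hα1 ht).1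
    (hc.stronglyMeasurableAtFilter isOpen_Ioi t ht) (hc.continuousAt (Ioi_mem_nhds ht))
  refine this.congr_of_eventuallyEq ?_
  filter_upwards [Ioi_mem_nhds ht] with x hx
  exact (integral_mlDZ hα hα1 hx).2.symm

lemma hasDerivAt_mlP (hα : 0 < α) (hα1 : α < 1) {t : ℝ} (ht : 0 < t) :
    HasDerivAt (mlP α) ((mlZ₂ α t - mlZ α t) / t ^ 2) t := by
  have h := (hasDerivAt_mlZ hα hα1 ht).div (hasDerivAt_id t) ht.ne'
  simp only [id, mul_one] at h
  rw [mul_comm, mul_mlDZ hα hα1 ht] at h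
  refine h.congr_of_eventuallyEq ?_
  filter_upwards [Ioi_mem_nhds ht] with x hx
  rw [Pi.div_apply, id, eq_div_iff (ne_of_gt hx), mul_comm, mul_mlP hα hα1 hx]

/-- Bounds for the derivatives of the relaxation function. -/
lemma exists_mlP_bound (hα : 0 < α) (hα1 : α < 1) : ∃ K, 0 < K ∧
    (∀ t, 0 < t → 1 - mlE α t ≤ K * min 1 (t ^ α)) ∧
    (∀ t, 0 < t → mlP α t ≤ K * min 1 (t ^ α) / t) ∧
    ∀ t s, 0 < t → t / 2 ≤ s → s ≤ t →
      |mlP α s - mlP α t| ≤ K * min 1 (t ^ α) / t ^ 2 * (t - s) := by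
  obtain ⟨K, hK, h⟩ := exists_mlZ_bound hα hα1
  have hM : ∀ t : ℝ, 0 < t → 0 < min 1 (t ^ α) := fun t ht =>
    lt_min one_pos (Real.rpow_pos_of_pos ht _)
  refine ⟨8 * K, by positivity, fun t ht => (h t ht).1.trans ?_, fun t ht => ?_,
    fun t s ht hs hst => ?_⟩
  · nlinarith [hM t ht]
  · rw [le_div_iff₀ ht, mul_comm, mul_mlP hα hα1 ht]
    refine (h t ht).2.1.trans ?_
    nlinarith [hM t ht]
  · have := (convex_Icc (t / 2) t).norm_image_sub_le_of_norm_hasDerivWithin_le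
      (f := mlP α) (f' := fun t => (mlZ₂ α t - mlZ α t) / t ^ 2)
      (C := 8 * K * min 1 (t ^ α) / t ^ 2) (x := t) (y := s)
      (fun x hx => (hasDerivAt_mlP hα hα1 (by linarith [hx.1])).hasDerivWithinAt)
      (fun x hx => by
        have hx0 : 0 < x := by linarith [hx.1]
        obtain ⟨-, h2, h3⟩ := h x hx0
        have h4 := min_rpow_mono hα hx0.le hx.2
        have h5 := mlZ_pos hα hα1 hx0
        have h6 : |mlZ₂ α x - mlZ α x| ≤ 2 * K * min 1 (t ^ α) := by
          rw [abs_le] at h3 ⊢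
          constructor <;> nlinarith
        rw [Real.norm_eq_abs, abs_div, abs_of_pos (pow_pos hx0 2), div_le_div_iff₀
          (by positivity) (by positivity)]
        have h7 : t ^ 2 ≤ 4 * x ^ 2 := by nlinarith [hx.1]
        have := hM t ht
        calc |mlZ₂ α x - mlZ α x| * t ^ 2 ≤ (2 * K * min 1 (t ^ α)) * (4 * x ^ 2) := by gcongr
          _ = _ := by ring) ⟨by linarith, le_rfl⟩ ⟨hs, hst⟩
    rwa [Real.norm_eq_abs, Real.norm_eq_abs, abs_sub_comm s t,
      abs_of_nonneg (sub_nonneg.2 hst)] at this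

end Bounds

section ScalarEquation

variable {α : ℝ} {F : Type*} [NormedAddCommGroup F] [NormedSpace ℝ F]

lemma integral_Ioo_rpow_smul (α : ℝ) (h : ℝ → F) {t : ℝ} (ht : 0 < t) :
    (1 / Real.Gamma (1 - α)) • ∫ s in Ioo 0 t, (t - s) ^ (-α) • h s =
      ∫ s in 0..t, fracKernel (1 - α) (t - s) • h s := by
  rw [intervalIntegral.integral_of_le ht.le, ← integral_Ioc_eq_integral_Ioo, ← integral_smul]
  refine integral_congr_ae (.of_forall fun s => ?_)
  simp only [fracKernel, smul_smul]
  congr 1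
  rw [show 1 - α - 1 = -α by ring]
  ring

variable [CompleteSpace F]

/-- The fractional differential equation in integrated form. -/
lemma volterra_of_caputo (hα : 0 < α) (hα1 : α < 1) {a a' : ℝ → F}
    (ha : ContinuousOn a (Ici 0)) (hd : ∀ t, 0 < t → HasDerivAt a (a' t) t)
    (hi : ∀ t, 0 < t → IntegrableOn (fun s => (t - s) ^ (-α) * ‖a' s‖) (Ioo 0 t))
    {l : ℝ}
    (he : ∀ t, 0 < t → (1 / Real.Gamma (1 - α)) • ∫ s in Ioo 0 t, (t - s) ^ (-α) • a' s = -l • a t)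
    {t : ℝ} (ht : 0 < t) :
    a t - a 0 = -l • ∫ s in 0..t, fracKernel α (t - s) • a s := by
  have hm : AEStronglyMeasurable a' (volume.restrict (Ioo 0 t)) := by
    refine (aestronglyMeasurable_deriv a _).congr ?_
    refine (ae_restrict_iff' measurableSet_Ioo).2 (.of_forall fun s hs => ?_)
    exact (hd s hs.1).deriv
  have h_integral : IntegrableOn a' (Ioo 0 t) := by
    refine ((hi t ht).const_mul (t ^ α)).mono' hm ?_
    refine (ae_restrict_iff' measurableSet_Ioo).2 (.of_forall fun s hs => ?_)
    have h1 : 0 < t - s := sub_pos.2 hs.2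
    have h2 : (t - s) ^ α ≤ t ^ α := Real.rpow_le_rpow h1.le (by linarith [hs.1]) hα.le
    have h3 := Real.rpow_pos_of_pos h1 α
    rw [← mul_assoc, Real.rpow_neg h1.le, ← div_eq_mul_inv]
    exact le_mul_of_one_le_left (norm_nonneg _) ((one_le_div h3).2 h2)
  have h_integral' : IntervalIntegrable a' volume 0 t := by
    rwa [intervalIntegrable_iff_integrableOn_Ioo_of_le ht.le]
  have ftc := intervalIntegral.integral_eq_sub_of_hasDerivAt_of_le ht.le
    (ha.mono Icc_subset_Ici_self) (fun s hs => hd s hs.1) h_integral'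
  have key := conv_assoc (f := fracKernel α) (g := fracKernel (1 - α)) (h := a')
    (Q := fun _ => 1) ht (continuousOn_fracKernel _) (continuousOn_fracKernel _) hm
    (fun x hx => fracKernel_nonneg hα hx.le)
    (fun x hx => fracKernel_nonneg (sub_pos.2 hα1) hx.le)
    (fun x hx => by
      have := fracKernel_conv hα (sub_pos.2 hα1) hx
      rwa [add_sub_cancel, fracKernel_one] at this)
    (by simpa [IntegrableOn] using h_integral.norm)
  simp only [one_smul] at key
  rw [← ftc, ← key, ← intervalIntegral.integral_smul]
  refine intervalIntegral.integral_congr_ae (.of_forall fun s hs => ?_)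
  rw [uIoc_of_le ht.le] at hs
  rw [← integral_Ioo_rpow_smul α a' hs.1, he s hs.1, smul_comm]

lemma fracKernel_mul {γ m t : ℝ} (hm : 0 ≤ m) (ht : 0 ≤ t) :
    fracKernel γ (m * t) = m ^ (γ - 1) * fracKernel γ t := by
  rw [fracKernel, fracKernel, Real.mul_rpow hm ht, mul_div_assoc]

/-- Uniqueness for the scalar fractional relaxation equation. -/
lemma eq_mlE_smul_of_caputo (hα : 0 < α) (hα1 : α < 1) {a a' : ℝ → F}
    (ha : ContinuousOn a (Ici 0)) (hd : ∀ t, 0 < t → HasDerivAt a (a' t) t)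
    (hi : ∀ t, 0 < t → IntegrableOn (fun s => (t - s) ^ (-α) * ‖a' s‖) (Ioo 0 t))
    {l : ℝ} (hl : 0 < l)
    (he : ∀ t, 0 < t → (1 / Real.Gamma (1 - α)) • ∫ s in Ioo 0 t, (t - s) ^ (-α) • a' s = -l • a t)
    {t : ℝ} (ht : 0 ≤ t) :
    a t = mlE α (l ^ (1 / α) * t) • a 0 := by
  set m := (l ^ (1 / α))⁻¹ with hm
  have hlp : 0 < l ^ (1 / α) := Real.rpow_pos_of_pos hl _
  have hm0 : 0 < m := inv_pos.2 hlp
  have hlm : l * m ^ α = 1 := by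
    rw [hm, Real.inv_rpow hlp.le, ← Real.rpow_mul hl.le, one_div_mul_cancel hα.ne', Real.rpow_one,
      mul_inv_cancel₀ hl.ne']
  have hE := continuousOn_mlE hα hα1
  have ham : ContinuousOn (fun s => a (m * s)) (Ici 0) :=
    ha.comp (by fun_prop) fun s hs => mul_nonneg hm0.le hs
  have hw : ContinuousOn (fun s => a (m * s) - mlE α s • a 0) (Ici 0) :=
    ham.sub (hE.smul continuousOn_const)
  have hE₀ : ContinuousOn (fun s => mlE α s • a 0) (Ici 0) := hE.smul continuousOn_const
  have kint : ∀ {b : ℝ → F} {t : ℝ}, 0 < t → ContinuousOn b (Ici 0) →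
      IntervalIntegrable (fun s => fracKernel α (t - s) • b s) volume 0 t := by
    intro b t ht hb
    have hk : IntervalIntegrable (fun s => fracKernel α (t - s)) volume 0 t := by
      simpa using ((intervalIntegrable_fracKernel hα 0 t).comp_sub_left t).symm
    exact hk.smul_continuousOn
      (hb.mono (by rw [uIcc_of_le ht.le]; exact Icc_subset_Ici_self))
  have hv : ∀ t, 0 < t → (a (m * t) - mlE α t • a 0) +
      ∫ s in 0..t, fracKernel α (t - s) • (a (m * s) - mlE α s • a 0) = 0 := by
    intro t ht
    have h1 := volterra_of_caputo hα hα1 ha hd hi he (mul_pos hm0 ht)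
    have h2 : ∫ s in 0..m * t, fracKernel α (m * t - s) • a s =
        m ^ α • ∫ s in 0..t, fracKernel α (t - s) • a (m * s) := by
      have := intervalIntegral.integral_comp_mul_left (a := 0) (b := t)
        (fun s => fracKernel α (m * t - s) • a s) hm0.ne'
      rw [mul_zero, eq_inv_smul_iff₀ hm0.ne'] at this
      rw [← this, ← intervalIntegral.integral_smul, ← intervalIntegral.integral_smul]
      refine intervalIntegral.integral_congr fun s hs => ?_
      rw [uIcc_of_le ht.le] at hs
      rw [← mul_sub, fracKernel_mul hm0.le (sub_nonneg.2 hs.2), smul_smul, smul_smul, ← mul_assoc]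
      congr 2
      rw [Real.rpow_sub_one hm0.ne']
      field_simp
    rw [h2, smul_smul, neg_mul, hlm, neg_one_smul, sub_eq_iff_eq_add] at h1
    have h3 : ∫ s in 0..t, fracKernel α (t - s) • (a (m * s) - mlE α s • a 0) =
        (∫ s in 0..t, fracKernel α (t - s) • a (m * s)) - (1 - mlE α t) • a 0 := by
      simp only [smul_sub]
      rw [intervalIntegral.integral_sub (kint ht ham) (kint ht hE₀),
        ← (conv_mlE hα hα1 ht).2, ← intervalIntegral.integral_smul_const]
      simp only [smul_smul]
    rw [h1, h3, sub_smul, one_smul]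
    abel
  rcases ht.eq_or_lt with rfl | ht
  · simp [mlE_zero hα]
  have hx : 0 < l ^ (1 / α) * t := mul_pos hlp ht
  have := norm_le_of_volterra hα hα1 hw (g := fun _ => 0) continuousOn_const hv
    (T := l ^ (1 / α) * t + 1) (G := 0) (by simp) ⟨hx, by linarith⟩
  rw [mul_zero, norm_le_zero_iff, sub_eq_zero, hm, inv_mul_cancel_left₀ hlp.ne'] at this
  exact this

end ScalarEquation

section Weights

variable {α : ℝ}

/-- Partial sums of the quadrature weights. -/
noncomputable def cqSum (α : ℝ) (i : ℕ) : ℝ := ∑ j ∈ Finset.range (i + 1), cqWeight α j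

lemma cqWeight_succ (α : ℝ) (j : ℕ) :
    cqWeight α (j + 1) * (j + 1) = cqWeight α j * (j - α) := by
  have : (Nat.factorial j : ℝ) ≠ 0 := by positivity
  have : (j : ℝ) + 1 ≠ 0 := by positivity
  rw [cqWeight, cqWeight, Finset.prod_range_succ, Nat.factorial_succ, pow_succ]
  push_cast
  field_simp
  ring

lemma cqSum_zero (α : ℝ) : cqSum α 0 = 1 := by simp [cqSum, cqWeight]

lemma cqSum_add_weight (α : ℝ) (i : ℕ) : cqSum α (i + 1) = cqSum α i + cqWeight α (i + 1) :=
  Finset.sum_range_succ _ _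

lemma cqWeight_succ_eq (α : ℝ) (i : ℕ) : cqWeight α (i + 1) * (i + 1) = -α * cqSum α i := by
  induction i with
  | zero => simp [cqSum, cqWeight]
  | succ i ih =>
    have h := cqWeight_succ α (i + 1)
    push_cast at h ⊢
    rw [h, cqSum_add_weight]
    linear_combination ih

lemma cqSum_succ (α : ℝ) (i : ℕ) : cqSum α (i + 1) * (i + 1) = cqSum α i * (i + 1 - α) := by
  rw [cqSum_add_weight]
  linear_combination cqWeight_succ_eq α i

lemma cqSum_eq (hα1 : α < 1) (i : ℕ) :
    cqSum α i = Real.Gamma (i + (1 - α)) / Real.Gamma (i + 1) / Real.Gamma (1 - α) := by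
  have h0 := (Real.Gamma_pos_of_pos (sub_pos.2 hα1)).ne'
  induction i with
  | zero => simp [cqSum_zero, h0]
  | succ i ih =>
    have hi : (0:ℝ) < i + 1 := by positivity
    have hi2 : 0 < (i:ℝ) + (1 - α) := by have := sub_pos.2 hα1; positivity
    have h := cqSum_succ α i
    rw [ih] at h
    have h1 := Real.Gamma_add_one hi2.ne'
    have h2 := Real.Gamma_add_one hi.ne'
    have h3 := (Real.Gamma_pos_of_pos hi).ne'
    push_cast
    rw [show (i:ℝ) + 1 + (1 - α) = i + (1 - α) + 1 by ring, h1, h2]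
    have hi' := hi.ne'
    field_simp at h ⊢
    linear_combination h

lemma sum_cqSum (hα1 : α < 1) (N : ℕ) :
    ∑ i ∈ Finset.range N, cqSum α i = N * cqSum α N / (1 - α) := by
  have h0 := (sub_pos.2 hα1).ne'
  induction N with
  | zero => simp
  | succ N ih =>
    rw [Finset.sum_range_succ, ih]
    have h := cqSum_succ α N
    push_cast
    field_simp
    linear_combination -h

lemma fracKernel_eq_rpow_neg (α t : ℝ) :
    fracKernel (1 - α) t = t ^ (-α) / Real.Gamma (1 - α) := by
  rw [fracKernel, show 1 - α - 1 = -α by ring]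

lemma fracKernel_antitone (hα : 0 < α) (hα1 : α < 1) {s t : ℝ} (hs : 0 < s) (hst : s ≤ t) :
    fracKernel (1 - α) t ≤ fracKernel (1 - α) s := by
  have := Real.Gamma_pos_of_pos (sub_pos.2 hα1)
  rw [fracKernel_eq_rpow_neg, fracKernel_eq_rpow_neg]
  gcongr ?_ / _
  exact Real.rpow_le_rpow_of_nonpos hs hst (by linarith)

lemma fracKernel_le_cqSum (hα : 0 < α) (hα1 : α < 1) (i : ℕ) :
    fracKernel (1 - α) (i + 1) ≤ cqSum α i := by
  have h0 := Real.Gamma_pos_of_pos (sub_pos.2 hα1)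
  have hi : (0:ℝ) < i + 1 := by positivity
  have hi2 : 0 < (i:ℝ) + (1 - α) := by have := sub_pos.2 hα1; positivity
  rw [fracKernel_eq_rpow_neg, cqSum_eq hα1]
  gcongr ?_ / _
  have h := Gamma_add_le_mul_rpow hi2 hα hα1
  rw [show (i:ℝ) + (1 - α) + α = i + 1 by ring] at h
  rw [le_div_iff₀ (Real.Gamma_pos_of_pos hi), Real.rpow_neg hi.le,
    inv_mul_le_iff₀ (Real.rpow_pos_of_pos hi _), mul_comm]
  refine h.trans ?_
  have := Real.Gamma_pos_of_pos hi2
  gcongr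
  linarith

lemma cqSum_le_fracKernel (hα : 0 < α) (hα1 : α < 1) {i : ℕ} (hi : 1 ≤ i) :
    cqSum α i ≤ fracKernel (1 - α) i := by
  have h0 := Real.Gamma_pos_of_pos (sub_pos.2 hα1)
  have hi : (0:ℝ) < i := by exact_mod_cast hi
  rw [fracKernel_eq_rpow_neg, cqSum_eq hα1]
  gcongr ?_ / _
  rw [div_le_iff₀ (Real.Gamma_pos_of_pos (by positivity)), Real.Gamma_add_one hi.ne']
  refine (Gamma_add_le_mul_rpow hi (sub_pos.2 hα1) (by linarith)).trans (le_of_eq ?_)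
  rw [sub_eq_neg_add, Real.rpow_add hi, Real.rpow_one]
  ring

lemma fracKernel_sub_le (hα : 0 < α) (hα1 : α < 1) {t : ℝ} (ht : 0 < t) :
    fracKernel (1 - α) t - fracKernel (1 - α) (t + 1) ≤ fracKernel (1 - α) t / t := by
  have ht1 : 0 < t + 1 := by linarith
  have h1 : ((t + 1) / t) ^ (-1 : ℝ) ≤ ((t + 1) / t) ^ (-α) :=
    Real.rpow_le_rpow_of_exponent_le ((one_le_div ht).2 (by linarith)) (by linarith)
  have h2 : fracKernel (1 - α) (t + 1) = ((t + 1) / t) ^ (-α) * fracKernel (1 - α) t := by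
    have := fracKernel_mul (γ := 1 - α) (div_pos ht1 ht).le ht.le
    rwa [div_mul_cancel₀ _ ht.ne', show 1 - α - 1 = -α by ring] at this
  have h3 := fracKernel_nonneg (sub_pos.2 hα1) ht.le
  rw [Real.rpow_neg_one, inv_div] at h1
  have h4 : 1 - t / (t + 1) ≤ 1 / t := by
    rw [one_sub_div ht1.ne', div_le_div_iff₀ ht1 ht]; linarith
  have h5 : fracKernel (1 - α) t / t = fracKernel (1 - α) t * (1 / t) := div_eq_mul_one_div _ t
  rw [h2, h5]
  nlinarith [mul_le_mul_of_nonneg_right h1 h3, mul_le_mul_of_nonneg_right h4 h3]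

lemma abs_fracKernel_sub_cqSum_le (hα : 0 < α) (hα1 : α < 1) {i : ℕ} (hi : 1 ≤ i) {x : ℝ}
    (h1 : (i:ℝ) ≤ x) (h2 : x ≤ i + 1) :
    |fracKernel (1 - α) x - cqSum α i| ≤ fracKernel (1 - α) i / i := by
  have hi0 : (0:ℝ) < i := by exact_mod_cast hi
  have := fracKernel_sub_le hα hα1 hi0
  have := fracKernel_antitone hα hα1 hi0 h1
  have := fracKernel_antitone hα hα1 (hi0.trans_le h1) h2
  have := fracKernel_le_cqSum hα hα1 i
  have := cqSum_le_fracKernel hα hα1 hi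
  rw [abs_le]
  constructor <;> linarith

lemma sum_integral_fracKernel_sub_cqSum (hα1 : α < 1) {N : ℕ} (hN : 1 ≤ N) :
    ∑ i ∈ Finset.range N, ((∫ x in (i:ℝ)..(i + 1), fracKernel (1 - α) x) - cqSum α i) =
      N / (1 - α) * (fracKernel (1 - α) N - cqSum α N) := by
  have h0 := sub_pos.2 hα1
  have hN0 : (0:ℝ) < N := by exact_mod_cast hN
  have h := intervalIntegral.sum_integral_adjacent_intervals (a := fun i : ℕ => (i:ℝ)) (n := N)
    (μ := volume) (f := fracKernel (1 - α)) fun i _ => intervalIntegrable_fracKernel h0 _ _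
  push_cast at h
  rw [Finset.sum_sub_distrib, h, sum_cqSum hα1, integral_fracKernel h0, Real.zero_rpow h0.ne',
    sub_zero, Real.Gamma_add_one h0.ne', fracKernel_eq_rpow_neg, sub_eq_add_neg 1 α,
    Real.rpow_add hN0, Real.rpow_one, ← sub_eq_add_neg]
  have := (Real.Gamma_pos_of_pos h0).ne'
  field_simp

lemma fracKernel_natCast_le (hα : 0 < α) (hα1 : α < 1) {n : ℕ} (hn : 1 ≤ n) {x : ℝ}
    (hx : (n:ℝ) ≤ 4 * x) : fracKernel (1 - α) x ≤ 4 * fracKernel (1 - α) n := by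
  have hn0 : (0:ℝ) < n := by exact_mod_cast hn
  have h := fracKernel_antitone hα hα1 (s := (1 / 4) * (n:ℝ)) (t := x) (by positivity) (by linarith)
  rw [fracKernel_mul (by norm_num) hn0.le] at h
  refine h.trans (mul_le_mul_of_nonneg_right ?_ (fracKernel_nonneg (sub_pos.2 hα1) hn0.le))
  rw [one_div, Real.inv_rpow (by norm_num), ← Real.rpow_neg (by norm_num)]
  simpa using Real.rpow_le_rpow_of_exponent_le (x := 4) (y := -(1 - α - 1)) (z := 1)
    (by norm_num) (by linarith)

end Weights

section Quadrature

variable {α : ℝ}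

lemma abs_fracKernel_sub_cqSum_mul_le (hα : 0 < α) (hα1 : α < 1) (i : ℕ) {x : ℝ}
    (h1 : (i:ℝ) < x) (h2 : x ≤ i + 1) :
    |fracKernel (1 - α) x - cqSum α i| * x ≤
      (8 + Real.Gamma (1 - α)) * fracKernel (1 - α) (i + 1) := by
  have h0 := sub_pos.2 hα1
  have hΓ := Real.Gamma_pos_of_pos h0
  rcases Nat.eq_zero_or_pos i with rfl | hi
  · simp only [Nat.cast_zero, zero_add] at h1 h2 ⊢
    have e1 : fracKernel (1 - α) 1 = 1 / Real.Gamma (1 - α) := by simp [fracKernel]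
    have e2 : fracKernel (1 - α) x * x ≤ fracKernel (1 - α) 1 := by
      rw [fracKernel_eq_rpow_neg, e1, div_mul_eq_mul_div]
      gcongr
      nth_rewrite 2 [← Real.rpow_one x]
      rw [← Real.rpow_add h1]
      exact Real.rpow_le_one h1.le h2 (by linarith)
    have e3 : Real.Gamma (1 - α) * fracKernel (1 - α) 1 = 1 := by
      rw [e1, mul_one_div_cancel hΓ.ne']
    have e4 := fracKernel_nonneg h0 h1.le
    have e5 := fracKernel_nonneg h0 zero_le_one
    rw [cqSum_zero, add_mul, e3]
    have : |fracKernel (1 - α) x - 1| ≤ fracKernel (1 - α) x + 1 := by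
      rw [abs_le]; constructor <;> linarith
    nlinarith
  · have hi0 : (1:ℝ) ≤ i := by exact_mod_cast hi
    have h3 := abs_fracKernel_sub_cqSum_le hα hα1 hi h1.le h2
    have h4 := fracKernel_natCast_le hα hα1 (n := i + 1) (x := i) (by omega)
      (by push_cast; linarith)
    push_cast at h4
    have h5 := fracKernel_nonneg h0 (t := (i:ℝ)) (by linarith)
    have h6 := fracKernel_nonneg h0 (t := (i:ℝ) + 1) (by linarith)
    calc _ ≤ fracKernel (1 - α) i / i * (2 * i) :=
          mul_le_mul h3 (by linarith) (by linarith) (by positivity)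
      _ = 2 * fracKernel (1 - α) i := by field_simp
      _ ≤ _ := by nlinarith

/-- Error of the convolution quadrature for the integral of the weakly singular kernel
against a density which is Lipschitz near the singularity. -/
lemma abs_quadrature_error_le (hα : 0 < α) (hα1 : α < 1) {n : ℕ} (hn : 2 ≤ n) {p : ℝ → ℝ}
    {L : ℝ} (hp : IntervalIntegrable p volume 0 n)
    (hkp : IntervalIntegrable (fun x => fracKernel (1 - α) x * p x) volume 0 n)
    (hp0 : ∀ x ∈ Ioo (0:ℝ) n, 0 ≤ p x) (hpL : |p 0| ≤ L)
    (hlip : ∀ x : ℝ, 0 ≤ x → 2 * x ≤ n → |p x - p 0| ≤ L / n * x)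
    (h_integral : ∫ x in (0:ℝ)..n, p x ≤ L * n) :
    |(∫ x in (0:ℝ)..n, fracKernel (1 - α) x * p x) -
        ∑ i ∈ Finset.range n, cqSum α i * ∫ x in (i:ℝ)..(i + 1), p x| ≤
      ((4 * (9 + Real.Gamma (1 - α))) / (1 - α) + 16) * fracKernel (1 - α) n * L := by
  have h0 := sub_pos.2 hα1
  have hΓ := Real.Gamma_pos_of_pos h0
  have hL : 0 ≤ L := (abs_nonneg _).trans hpL
  have hn0 : (0:ℝ) < n := by exact_mod_cast (by omega : 0 < n)
  obtain ⟨m, hm1, hm2, hm4⟩ : ∃ m : ℕ, 1 ≤ m ∧ 2 * m ≤ n ∧ n ≤ 4 * m :=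
    ⟨n / 2, by omega, by omega, by omega⟩
  have hm0 : (0:ℝ) < m := by exact_mod_cast hm1
  have hm2' : 2 * (m:ℝ) ≤ n := by exact_mod_cast hm2
  have hm4' : (n:ℝ) ≤ 4 * m := by exact_mod_cast hm4
  set k := fracKernel (1 - α) with hk
  have hkn := fracKernel_nonneg h0 hn0.le
  have hkm := fracKernel_nonneg h0 hm0.le
  have hkmn : k m ≤ 4 * k n := fracKernel_natCast_le hα hα1 (by omega) hm4'
  have sub : ∀ i < n, uIcc (i:ℝ) (i + 1) ⊆ uIcc 0 (n:ℝ) := by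
    intro i hi
    rw [uIcc_of_le (by linarith), uIcc_of_le hn0.le]
    exact Icc_subset_Icc (by positivity) (by exact_mod_cast hi)
  have ip : ∀ i < n, IntervalIntegrable p volume i (i + 1) := fun i hi => hp.mono_set (sub i hi)
  have ikp : ∀ i < n, IntervalIntegrable (fun x => k x * p x) volume i (i + 1) :=
    fun i hi => hkp.mono_set (sub i hi)
  have ik : ∀ i : ℕ, IntervalIntegrable k volume i (i + 1) :=
    fun i => intervalIntegrable_fracKernel h0 _ _
  set q : ℕ → ℝ := fun i => (∫ x in (i:ℝ)..(i + 1), k x * p x) -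
    cqSum α i * ∫ x in (i:ℝ)..(i + 1), p x with hq
  have hsplit : (∫ x in (0:ℝ)..n, k x * p x) -
      ∑ i ∈ Finset.range n, cqSum α i * ∫ x in (i:ℝ)..(i + 1), p x =
      ∑ i ∈ Finset.range m, q i + ∑ i ∈ Finset.Ico m n, q i := by
    have h := intervalIntegral.sum_integral_adjacent_intervals (a := fun i : ℕ => (i:ℝ)) (n := n)
      (μ := volume) (f := fun x => k x * p x) fun i hi => by
        push_cast; exact ikp i hi
    push_cast at h
    rw [Finset.sum_range_add_sum_Ico _ (by omega), hq, Finset.sum_sub_distrib, h]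
  have near : ∀ i ∈ Finset.range m, |q i - p 0 * ((∫ x in (i:ℝ)..(i + 1), k x) - cqSum α i)| ≤
      (8 + Real.Gamma (1 - α)) * (L / n) * cqSum α i := by
    intro i hi
    rw [Finset.mem_range] at hi
    have him : (i:ℝ) + 1 ≤ m := by exact_mod_cast hi
    have e : q i - p 0 * ((∫ x in (i:ℝ)..(i + 1), k x) - cqSum α i) =
        ∫ x in (i:ℝ)..(i + 1), (k x - cqSum α i) * (p x - p 0) := by
      have : ∀ x, (k x - cqSum α i) * (p x - p 0) =
          (k x * p x - cqSum α i * p x) - (p 0 * k x - p 0 * cqSum α i) := fun x => by ring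
      simp only [this]
      have i1 := ikp i (by omega)
      have i2 := (ip i (by omega)).const_mul (cqSum α i)
      have i3 := (ik i).const_mul (p 0)
      rw [intervalIntegral.integral_sub (i1.sub i2) (i3.sub intervalIntegrable_const),
        intervalIntegral.integral_sub i1 i2,
        intervalIntegral.integral_sub i3 intervalIntegrable_const,
        intervalIntegral.integral_const_mul, intervalIntegral.integral_const_mul,
        intervalIntegral.integral_const, hq]
      simp only [add_sub_cancel_left, one_smul]
      ring
    rw [e]
    have := intervalIntegral.norm_integral_le_of_norm_le_const (a := (i:ℝ)) (b := i + 1)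
      (f := fun x => (k x - cqSum α i) * (p x - p 0))
      (C := (8 + Real.Gamma (1 - α)) * (L / n) * cqSum α i) fun x hx => by
        rw [uIoc_of_le (by linarith)] at hx
        have hx0 : 0 ≤ x := le_trans (by positivity) hx.1.le
        have h1 := hlip x hx0 (by linarith [hx.2])
        have h2 := abs_fracKernel_sub_cqSum_mul_le hα hα1 i hx.1 hx.2
        have h3 := fracKernel_le_cqSum hα hα1 i
        rw [Real.norm_eq_abs, abs_mul]
        calc |k x - cqSum α i| * |p x - p 0| ≤ |k x - cqSum α i| * (L / n * x) := by gcongr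
          _ = |k x - cqSum α i| * x * (L / n) := by ring
          _ ≤ (8 + Real.Gamma (1 - α)) * cqSum α i * (L / n) := by
              refine mul_le_mul_of_nonneg_right (h2.trans ?_) (by positivity)
              gcongr
          _ = _ := by ring
    simpa using this
  have far : ∀ i ∈ Finset.Ico m n, |q i| ≤ 16 * k n / n * ∫ x in (i:ℝ)..(i + 1), p x := by
    intro i hi
    rw [Finset.mem_Ico] at hi
    have hmi : (m:ℝ) ≤ i := by exact_mod_cast hi.1
    have hin : (i:ℝ) + 1 ≤ n := by exact_mod_cast hi.2
    have i1 := ikp i hi.2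
    have i2 := (ip i hi.2).const_mul (cqSum α i)
    have e : q i = ∫ x in (i:ℝ)..(i + 1), (k x * p x - cqSum α i * p x) := by
      rw [intervalIntegral.integral_sub i1 i2, intervalIntegral.integral_const_mul]
    rw [e, ← intervalIntegral.integral_const_mul, ← Real.norm_eq_abs]
    refine intervalIntegral.norm_integral_le_of_norm_le (by linarith)
      ((ae_restrict_iff' measurableSet_Ioc).1 ?_) ((ip i hi.2).const_mul _)
    rw [← restrict_Ioo_eq_restrict_Ioc]
    refine (ae_restrict_iff' measurableSet_Ioo).2 (.of_forall fun x hx => ?_)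
    have hpx := hp0 x ⟨by linarith [hx.1], by linarith [hx.2]⟩
    have h1 := abs_fracKernel_sub_cqSum_le hα hα1 (hm1.trans hi.1) hx.1.le hx.2.le
    have h2 := fracKernel_antitone hα hα1 hm0 hmi
    rw [← sub_mul, norm_mul, Real.norm_of_nonneg hpx, Real.norm_eq_abs]
    gcongr
    refine h1.trans ?_
    calc k i / i ≤ (4 * k n) / (n / 4) := by
          gcongr
          · exact h2.trans hkmn
          · linarith
      _ = _ := by field_simp; ring
  have nn : ∀ i ∈ Finset.range n, 0 ≤ ∫ x in (i:ℝ)..(i + 1), p x := by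
    intro i hi
    rw [Finset.mem_range] at hi
    have hin : (i:ℝ) + 1 ≤ n := by exact_mod_cast hi
    have := intervalIntegral.integral_mono_on_of_le_Ioo (by linarith)
      intervalIntegrable_const (ip i hi) fun x hx =>
      hp0 x ⟨lt_of_le_of_lt (by positivity) hx.1, by linarith [hx.2]⟩
    simpa using this
  have S1 := sum_integral_fracKernel_sub_cqSum hα1 hm1
  have S2 := sum_cqSum hα1 m
  have S3 : ∑ i ∈ Finset.Ico m n, ∫ x in (i:ℝ)..(i + 1), p x ≤ L * n := by
    refine (Finset.sum_le_sum_of_subset_of_nonneg (t := Finset.range n) ?_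
      fun i hi _ => nn i hi).trans ?_
    · intro i hi
      simp only [Finset.mem_Ico, Finset.mem_range] at hi ⊢
      omega
    have h := intervalIntegral.sum_integral_adjacent_intervals (a := fun i : ℕ => (i:ℝ)) (n := n)
      (μ := volume) (f := p) fun i hi => by push_cast; exact ip i hi
    push_cast at h
    rw [h]
    exact h_integral
  have F1 : |∑ i ∈ Finset.Ico m n, q i| ≤ 16 * k n * L := by
    refine (Finset.abs_sum_le_sum_abs _ _).trans ((Finset.sum_le_sum far).trans ?_)
    rw [← Finset.mul_sum]
    calc _ ≤ 16 * k n / n * (L * n) := by gcongr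
      _ = _ := by field_simp
  have hBm := cqSum_le_fracKernel hα hα1 hm1
  have hBm' := fracKernel_le_cqSum hα hα1 m
  have hkk := fracKernel_sub_le hα hα1 hm0
  have N1 : |∑ i ∈ Finset.range m, (q i - p 0 * ((∫ x in (i:ℝ)..(i + 1), k x) - cqSum α i))| ≤
      (8 + Real.Gamma (1 - α)) * (4 / (1 - α)) * k n * L := by
    refine (Finset.abs_sum_le_sum_abs _ _).trans ((Finset.sum_le_sum near).trans ?_)
    rw [← Finset.mul_sum, S2]
    have hmB : m * cqSum α m ≤ n * (4 * k n) :=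
      mul_le_mul (by linarith) (hBm.trans hkmn)
        ((fracKernel_nonneg h0 (by linarith)).trans hBm') hn0.le
    calc _ ≤ (8 + Real.Gamma (1 - α)) * (L / n) * (n * (4 * k n) / (1 - α)) := by gcongr
      _ = _ := by field_simp
  have N2 : |p 0 * ∑ i ∈ Finset.range m, ((∫ x in (i:ℝ)..(i + 1), k x) - cqSum α i)| ≤
      4 / (1 - α) * k n * L := by
    rw [S1, abs_mul, abs_mul, abs_of_nonneg (div_nonneg hm0.le h0.le),
      abs_of_nonneg (sub_nonneg.2 hBm)]
    have hd : k m - cqSum α m ≤ k m / m := by linarith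
    calc _ ≤ L * (m / (1 - α) * (k m / m)) :=
          mul_le_mul hpL (mul_le_mul_of_nonneg_left hd (div_nonneg hm0.le h0.le))
            (mul_nonneg (div_nonneg hm0.le h0.le) (sub_nonneg.2 hBm)) hL
      _ = 1 / (1 - α) * k m * L := by field_simp
      _ ≤ 1 / (1 - α) * (4 * k n) * L := by gcongr
      _ = _ := by ring
  rw [Finset.sum_sub_distrib, ← Finset.mul_sum] at N1
  rw [hsplit]
  have fin : ∀ a b c : ℝ, |a + b| ≤ |a - c| + |c| + |b| := fun a b c => by
    calc |a + b| = |(a - c) + c + b| := by congr 1; ring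
      _ ≤ _ := (abs_add_le _ _).trans (by gcongr; exact abs_add_le _ _)
  refine (fin _ _ _).trans ((add_le_add (add_le_add N1 N2) F1).trans (le_of_eq ?_))
  ring

end Quadrature

section ScalarError

variable {α : ℝ}

lemma sum_cqWeight_mul (α : ℝ) (c : ℕ → ℝ) (n N : ℕ) :
    ∑ j ∈ Finset.range (N + 1), cqWeight α j * c (n - j) =
      cqSum α N * c (n - N) +
        ∑ i ∈ Finset.range N, cqSum α i * (c (n - i) - c (n - (i + 1))) := by
  induction N with
  | zero => simp [cqSum]
  | succ N ih =>
    rw [Finset.sum_range_succ, ih, Finset.sum_range_succ, cqSum_add_weight]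
    ring

lemma intervalIntegrable_comp_sub_mul {f : ℝ → ℝ} {a b τ d : ℝ} (hτ : τ ≠ 0)
    (hf : IntervalIntegrable f volume (d - τ * b) (d - τ * a)) :
    IntervalIntegrable (fun x => f (d - τ * x)) volume a b := by
  have h := ((hf.comp_sub_left d).comp_mul_left (c := τ)).symm
  simpa [hτ] using h

/-- Rescaled form of the identity `fracKernel (1 - α) ∗ mlP α = mlE α`. -/
lemma integral_fracKernel_mul_mlP (hα : 0 < α) (hα1 : α < 1) {τ n : ℝ} (hτ : 0 < τ) (hn : 0 < n) :
    IntervalIntegrable (fun x => fracKernel (1 - α) x * (τ * mlP α (n * τ - τ * x))) volume 0 n ∧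
      ∫ x in (0:ℝ)..n, fracKernel (1 - α) x * (τ * mlP α (n * τ - τ * x)) =
        τ ^ α * mlE α (n * τ) := by
  obtain ⟨hi, he⟩ := conv_mlP hα hα1 (mul_pos hn hτ)
  set f : ℝ → ℝ := fun s => fracKernel (1 - α) (n * τ - s) * mlP α s with hf
  have e0 : n * τ - τ * n = 0 := by ring
  have e1 : n * τ - τ * 0 = n * τ := by ring
  have key : ∀ x ∈ uIcc 0 n, fracKernel (1 - α) x * (τ * mlP α (n * τ - τ * x)) =
      τ ^ (1 + α) * f (n * τ - τ * x) := by
    intro x hx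
    rw [uIcc_of_le hn.le] at hx
    have e : n * τ - (n * τ - τ * x) = τ * x := by ring
    simp only [hf]
    rw [e, fracKernel_mul hτ.le hx.1, Real.rpow_add hτ, Real.rpow_one,
      show 1 - α - 1 = -α by ring, Real.rpow_neg hτ.le]
    have := (Real.rpow_pos_of_pos hτ α).ne'
    field_simp
  have hi' : IntervalIntegrable (fun x => f (n * τ - τ * x)) volume 0 n :=
    intervalIntegrable_comp_sub_mul hτ.ne' (by rw [e0, e1]; exact hi)
  refine ⟨(hi'.const_mul (τ ^ (1 + α))).congr fun x hx => (key x (uIoc_subset_uIcc hx)).symm, ?_⟩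
  rw [intervalIntegral.integral_congr key, intervalIntegral.integral_const_mul,
    intervalIntegral.integral_comp_sub_mul f hτ.ne', e0, e1, he, smul_eq_mul, Real.rpow_add hτ,
    Real.rpow_one]
  field_simp

lemma integral_mul_mlP (hα : 0 < α) (hα1 : α < 1) {τ n a b : ℝ} (hτ : 0 < τ)
    (ha : a ≤ n) (hb : b ≤ n) :
    IntervalIntegrable (fun x => τ * mlP α (n * τ - τ * x)) volume a b ∧
      ∫ x in a..b, τ * mlP α (n * τ - τ * x) =
        mlE α ((n - b) * τ) - mlE α ((n - a) * τ) := by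
  have e : ∀ x, n * τ - τ * x = (n - x) * τ := fun x => by ring
  obtain ⟨h1, h2⟩ := mlE_sub hα hα1 (mul_nonneg (sub_nonneg.2 hb) hτ.le)
    (mul_nonneg (sub_nonneg.2 ha) hτ.le)
  refine ⟨(intervalIntegrable_comp_sub_mul hτ.ne' (by rwa [e, e])).const_mul τ, ?_⟩
  rw [intervalIntegral.integral_const_mul,
    intervalIntegral.integral_comp_sub_mul (mlP α) hτ.ne', e, e, h2, smul_eq_mul,
    mul_inv_cancel_left₀ hτ.ne']

lemma rpow_neg_mul_min {x : ℝ} (hx : 0 < x) : x ^ (-α) * min 1 (x ^ α) = min (x ^ (-α)) 1 := by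
  rw [mul_min_of_nonneg _ _ (Real.rpow_nonneg hx.le _), mul_one, ← Real.rpow_add hx,
    neg_add_cancel, Real.rpow_zero]

/-- Consistency error of the backward Euler quadrature for the Mittag-Leffler function. -/
lemma exists_mlE_cq_error_le (hα : 0 < α) (hα1 : α < 1) : ∃ C, 0 < C ∧
    ∀ τ : ℝ, 0 < τ → ∀ n : ℕ, 1 ≤ n →
      |mlE α (n * τ) + τ ^ (-α) * ∑ j ∈ Finset.range (n + 1),
          cqWeight α j * (mlE α ((n - j : ℕ) * τ) - 1)| ≤
        C / n * min ((n * τ) ^ (-α)) 1 := by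
  obtain ⟨K, hK, hK1, hK2, hK3⟩ := exists_mlP_bound hα hα1
  have h0 := sub_pos.2 hα1
  have hΓ := Real.Gamma_pos_of_pos h0
  have hΓ1 := Real.Gamma_pos_of_pos (add_pos hα one_pos)
  set D := (4 * (9 + Real.Gamma (1 - α))) / (1 - α) + 16 with hD
  have hDp : 0 < D := by positivity
  refine ⟨D / Real.Gamma (1 - α) * K + (1 + Real.Gamma (α + 1) + K), by positivity,
    fun τ hτ n hn => ?_⟩
  have hn0 : (0:ℝ) < n := by exact_mod_cast hn
  have ht : 0 < n * τ := mul_pos hn0 hτ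
  have hmin : 0 < min ((n * τ) ^ (-α)) 1 := lt_min (Real.rpow_pos_of_pos ht _) one_pos
  rcases hn.eq_or_lt with rfl | hn2
  · have hE0 := mlE_nonneg hα hα1 hτ.le
    have hE1 := mlE_le_one hα hα1 hτ.le
    have hE2 := mlE_mul_le hα hα1 hτ.le
    have hE3 := hK1 τ hτ
    have hτa := Real.rpow_pos_of_pos hτ α
    have e : ∑ j ∈ Finset.range (1 + 1), cqWeight α j * (mlE α ((1 - j : ℕ) * τ) - 1) =
        mlE α τ - 1 := by
      simp [Finset.sum_range_succ, cqWeight, mlE_zero hα]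
    rw [e]
    simp only [Nat.cast_one, one_mul, div_one] at hmin ⊢
    have b1 : mlE α τ ≤ (1 + Real.Gamma (α + 1)) * min (τ ^ (-α)) 1 := by
      have h1 : mlE α τ ≤ Real.Gamma (α + 1) * τ ^ (-α) := by
        rw [Real.rpow_neg hτ.le, ← div_eq_mul_inv, le_div_iff₀ hτa]
        rw [mul_div_assoc', div_le_one hΓ1] at hE2
        exact hE2
      have h2 := (Real.rpow_pos_of_pos hτ (-α)).le
      rw [mul_min_of_nonneg _ _ (by positivity)]
      exact le_min (h1.trans (by gcongr; linarith)) (by linarith)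
    have b2 : τ ^ (-α) * (1 - mlE α τ) ≤ K * min (τ ^ (-α)) 1 := by
      rw [← rpow_neg_mul_min hτ, mul_left_comm]
      gcongr
    have b3 : 0 ≤ τ ^ (-α) * (1 - mlE α τ) := mul_nonneg (Real.rpow_nonneg hτ.le _) (by linarith)
    have b4 : 0 ≤ D / Real.Gamma (1 - α) * K * min (τ ^ (-α)) 1 := by positivity
    rw [abs_le]
    constructor <;> nlinarith
  · have hn2' : 2 ≤ n := hn2
    obtain ⟨i1, e1⟩ := integral_fracKernel_mul_mlP hα hα1 hτ hn0
    set p : ℝ → ℝ := fun x => τ * mlP α (n * τ - τ * x) with hp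
    obtain ⟨i2, e2⟩ := integral_mul_mlP hα hα1 hτ hn0.le le_rfl
    set M := min 1 ((n * τ : ℝ) ^ α) with hM
    have hM0 : 0 < M := lt_min one_pos (Real.rpow_pos_of_pos ht _)
    have hp0 : p 0 = τ * mlP α (n * τ) := by simp [hp]
    have key := abs_quadrature_error_le hα hα1 hn2' (p := p) (L := K * M / n) i2 i1
      (fun x hx => (mul_pos hτ (mlP_pos hα hα1 (by nlinarith [hx.2]))).le)
      (by
        rw [hp0, abs_of_nonneg (mul_pos hτ (mlP_pos hα hα1 ht)).le]
        calc τ * mlP α (n * τ) ≤ τ * (K * M / (n * τ)) := by gcongr; exact hK2 _ ht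
          _ = _ := by field_simp)
      (fun x hx hxn => by
        rw [hp0, hp, ← mul_sub, abs_mul, abs_of_pos hτ]
        calc τ * |mlP α (n * τ - τ * x) - mlP α (n * τ)|
            ≤ τ * (K * M / (n * τ) ^ 2 * (n * τ - (n * τ - τ * x))) := by
              gcongr
              exact hK3 _ _ ht (by nlinarith) (by nlinarith)
          _ = _ := by field_simp; ring)
      (by
        rw [e2]
        simp only [sub_self, zero_mul, sub_zero, mlE_zero hα]
        calc 1 - mlE α (n * τ) ≤ K * M := hK1 _ ht
          _ = _ := by field_simp)
    rw [e1] at key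
    have e3 : ∑ j ∈ Finset.range (n + 1), cqWeight α j * (mlE α ((n - j : ℕ) * τ) - 1) =
        - ∑ i ∈ Finset.range n, cqSum α i * ∫ x in (i:ℝ)..(i + 1), p x := by
      rw [sum_cqWeight_mul α (fun m => mlE α (m * τ) - 1), ← Finset.sum_neg_distrib]
      simp only [Nat.sub_self, Nat.cast_zero, zero_mul, mlE_zero hα, sub_self, mul_zero, zero_add]
      refine Finset.sum_congr rfl fun i hi => ?_
      rw [Finset.mem_range] at hi
      have hin : (i:ℝ) + 1 ≤ n := by exact_mod_cast hi
      rw [(integral_mul_mlP hα hα1 hτ (by linarith) hin).2, Nat.cast_sub hi.le,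
        Nat.cast_sub hi]
      push_cast
      ring
    have hτa := Real.rpow_pos_of_pos hτ α
    have hτn : τ ^ (-α) * τ ^ α = 1 := by
      rw [← Real.rpow_add hτ, neg_add_cancel, Real.rpow_zero]
    set S := ∑ i ∈ Finset.range n, cqSum α i * ∫ x in (i:ℝ)..(i + 1), p x
    have e4 : mlE α (n * τ) + τ ^ (-α) * -S = τ ^ (-α) * (τ ^ α * mlE α (n * τ) - S) := by
      linear_combination (-mlE α (n * τ)) * hτn
    have hnn := Real.rpow_nonneg hτ.le (-α)
    rw [e3, e4, abs_mul, abs_of_nonneg hnn]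
    calc _ ≤ τ ^ (-α) * (D * fracKernel (1 - α) n * (K * M / n)) := by gcongr
      _ = D / Real.Gamma (1 - α) * K / n * ((n * τ) ^ (-α) * M) := by
          rw [fracKernel_eq_rpow_neg, Real.mul_rpow hn0.le hτ.le]
          ring
      _ ≤ _ := by
          rw [hM, rpow_neg_mul_min ht]
          gcongr
          have : 0 < 1 + Real.Gamma (α + 1) + K := by positivity
          linarith

end ScalarError

section spectral

variable {V : Type} [NormedAddCommGroup V] [InnerProductSpace ℂ V]

lemma aeval_apply_of_eigenvector {A : V →L[ℂ] V} {e : V} {l : ℝ} (h : A e = l • e)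
    (p : Polynomial ℝ) : Polynomial.aeval A p e = p.eval l • e := by
  induction p using Polynomial.induction_on' with
  | add p q hp hq => simp [hp, hq, add_smul]
  | monomial k a =>
    have hk : (A ^ k) e = l ^ k • e := by
      induction k with
      | zero => simp
      | succ k ih =>
        rw [pow_succ', mul_apply_eq_comp, ih, ContinuousLinearMap.map_smul_of_tower, h, smul_smul,
          pow_succ]
    rw [Polynomial.aeval_monomial, Polynomial.eval_monomial, mul_apply_eq_comp, hk,
      Algebra.algebraMap_eq_smul_one, smul_apply, one_apply_eq_self, smul_smul]

lemma cfc_apply_eigenvectorBasis [FiniteDimensional ℂ V] {ι : Type*} [Fintype ι] {A : V →L[ℂ] V}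
    (hA : IsSelfAdjoint A) (b : OrthonormalBasis ι ℂ V) {l : ι → ℝ} (hb : ∀ i, A (b i) = l i • b i)
    (f : ℝ → ℝ) (i : ι) :
    cfc f A (b i) = f (l i) • b i := by
  classical
  set s : Finset ℝ := Finset.univ.image l with hs
  set q : Polynomial ℝ := ∏ x ∈ s, (Polynomial.X - Polynomial.C x) with hq
  set p : Polynomial ℝ := Lagrange.interpolate s id f with hp
  have hl : ∀ j, l j ∈ s := fun j => Finset.mem_image_of_mem _ (Finset.mem_univ _)
  have hpe : ∀ x ∈ s, p.eval x = f x := fun x hx =>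
    Lagrange.eval_interpolate_at_node f (Function.injective_id.injOn) hx
  have hq0 : Polynomial.aeval A q = 0 := by
    have : (Polynomial.aeval A q : V →ₗ[ℂ] V) = 0 := by
      refine b.toBasis.ext fun j => ?_
      have : q.eval (l j) = 0 := by
        rw [hq, Polynomial.eval_prod]
        exact Finset.prod_eq_zero (hl j) (by simp)
      simp [aeval_apply_of_eigenvector (hb j), this]
    exact ContinuousLinearMap.coe_injective this
  have hsp : spectrum ℝ A ⊆ s := by
    intro x hx
    have : Nontrivial (V →L[ℂ] V) := by
      by_contra h
      rw [not_nontrivial_iff_subsingleton] at h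
      simp at hx
    have := spectrum.subset_polynomial_aeval A q ⟨x, hx, rfl⟩
    rw [hq0, spectrum.zero_eq, mem_singleton_iff] at this
    simp only [hq, Polynomial.eval_prod, Finset.prod_eq_zero_iff] at this
    obtain ⟨y, hy, h⟩ := this
    simp only [Polynomial.eval_sub, Polynomial.eval_X, Polynomial.eval_C, sub_eq_zero] at h
    exact h ▸ hy
  have h1 : cfc f A = cfc p.eval A := cfc_congr fun x hx => (hpe x (hsp hx)).symm
  rw [h1, cfc_polynomial p A, aeval_apply_of_eigenvector (hb i), hpe _ (hl i)]

lemma inner_ofReal_smul_left (r : ℝ) (x y : V) : ⟪r • x, y⟫ = r • ⟪x, y⟫ := by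
  rw [← Complex.coe_smul, inner_smul_left, Complex.conj_ofReal, Complex.real_smul]

lemma inner_ofReal_smul_right (r : ℝ) (x y : V) : ⟪x, r • y⟫ = r • ⟪x, y⟫ := by
  rw [← Complex.coe_smul, inner_smul_right, Complex.real_smul]

lemma inner_apply_of_eigenvector [FiniteDimensional ℂ V] {B : V →L[ℂ] V} (hB : IsSelfAdjoint B)
    {e : V} {r : ℝ}
    (h : B e = r • e) (x : V) : ⟪e, B x⟫ = r • ⟪e, x⟫ := by
  have := (ContinuousLinearMap.isSelfAdjoint_iff_isSymmetric.1 hB) e x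
  simp only [ContinuousLinearMap.coe_coe] at this
  rw [← this, h, inner_ofReal_smul_left]

lemma norm_le_mul_of_norm_inner_le {ι : Type*} [Fintype ι] (b : OrthonormalBasis ι ℂ V) {K : ℝ}
    (hK : 0 ≤ K) {x y : V} (h : ∀ i, ‖⟪b i, x⟫‖ ≤ K * ‖⟪b i, y⟫‖) : ‖x‖ ≤ K * ‖y‖ := by
  refine le_of_sq_le_sq ?_ (by positivity)
  rw [mul_pow, ← b.sum_sq_norm_inner_right x, ← b.sum_sq_norm_inner_right y, Finset.mul_sum]
  refine Finset.sum_le_sum fun i _ => ?_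
  rw [← mul_pow]
  exact pow_le_pow_left₀ (norm_nonneg _) (h i) 2

end spectral

lemma integrableOn_rpow_smul {V : Type*} [NormedAddCommGroup V] [NormedSpace ℝ V] [CompleteSpace V]
    [SecondCountableTopology V] {α t : ℝ} {u u' : ℝ → V}
    (hd : ∀ t : ℝ, 0 < t → HasDerivAt u (u' t) t)
    (hi : IntegrableOn (fun s => (t - s) ^ (-α) * ‖u' s‖) (Ioo 0 t)) :
    IntegrableOn (fun s => (t - s) ^ (-α) • u' s) (Ioo 0 t) := by
  have hm : AEStronglyMeasurable u' (volume.restrict (Ioo 0 t)) :=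
    (stronglyMeasurable_deriv u).aestronglyMeasurable.congr
      ((ae_restrict_iff' measurableSet_Ioo).2 (.of_forall fun s hs => (hd s hs.1).deriv))
  refine Integrable.mono' hi (AEStronglyMeasurable.smul
    ((measurable_const.sub measurable_id).pow_const _).aestronglyMeasurable hm)
    ((ae_restrict_iff' measurableSet_Ioo).2 (.of_forall fun s hs => ?_))
  rw [norm_smul, Real.norm_of_nonneg (Real.rpow_nonneg (sub_nonneg.2 hs.2.le) _)]

lemma caputo_clm_comp {V : Type} [NormedAddCommGroup V] [NormedSpace ℝ V] [CompleteSpace V]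
    [SecondCountableTopology V] {W : Type} [NormedAddCommGroup W] [NormedSpace ℝ W]
    [CompleteSpace W] (L : V →L[ℝ] W) {α t : ℝ} {u u' : ℝ → V}
    (hd : ∀ t : ℝ, 0 < t → HasDerivAt u (u' t) t)
    (hi : IntegrableOn (fun s => (t - s) ^ (-α) * ‖u' s‖) (Ioo 0 t)) :
    caputo α (fun s => L (u' s)) t = L (caputo α u' t) := by
  rw [caputo, caputo, map_smul, ← L.integral_comp_comm (integrableOn_rpow_smul hd hi)]
  simp only [map_smul]

/-- A solution of the fractional evolution equation is a Mittag-Leffler function along each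
eigenvector. -/
lemma inner_eq_mlE_smul {V : Type} [NormedAddCommGroup V] [InnerProductSpace ℂ V]
    [FiniteDimensional ℂ V] {α : ℝ} (hα : 0 < α) (hα1 : α < 1) {A : V →L[ℂ] V}
    (hA : IsSelfAdjoint A) {e : V} {l : ℝ} (hl : 0 < l) (hAe : A e = l • e)
    {u u' : ℝ → V} (hu : ContinuousOn u (Ici 0))
    (hd : ∀ t : ℝ, 0 < t → HasDerivAt u (u' t) t)
    (hi : ∀ t : ℝ, 0 < t → IntegrableOn (fun s => (t - s) ^ (-α) * ‖u' s‖) (Ioo 0 t))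
    (h : ∀ t : ℝ, 0 < t → caputo α u' t + A (u t) = 0) {t : ℝ} (ht : 0 ≤ t) :
    ⟪e, u t⟫ = mlE α (l ^ (1 / α) * t) • ⟪e, u 0⟫ := by
  set L : V →L[ℝ] ℂ := (innerSL ℂ e).restrictScalars ℝ with hL
  have hLx : ∀ x, L x = ⟪e, x⟫ := fun x => rfl
  have hd' : ∀ t : ℝ, 0 < t → HasDerivAt (fun t => L (u t)) (L (u' t)) t := fun t ht =>
    L.hasFDerivAt.comp_hasDerivAt t (hd t ht)
  refine eq_mlE_smul_of_caputo hα hα1 (a := fun t => L (u t)) (a' := fun t => L (u' t))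
    (L.continuous.comp_continuousOn hu) hd' (fun t ht => ?_) hl (fun t ht => ?_) ht
  · refine ((L.integrable_comp (integrableOn_rpow_smul hd (hi t ht))).norm.congr
      ((ae_restrict_iff' measurableSet_Ioo).2 (.of_forall fun s hs => ?_)))
    simp only [map_smul]
    rw [norm_smul, Real.norm_of_nonneg (Real.rpow_nonneg (sub_nonneg.2 hs.2.le) _)]
  · have := caputo_clm_comp L hd (hi t ht)
    rw [caputo] at this
    rw [this, eq_neg_of_add_eq_zero_left (h t ht), map_neg, hLx, hLx,
      inner_apply_of_eigenvector hA hAe, neg_smul]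

/-- The quadrature error for the scalar problem with decay rate `l`, uniformly in `l`. -/
lemma exists_scalar_cq_error_le {α β : ℝ} (hα : 0 < α) (hα1 : α < 1) (hβ0 : 0 ≤ β) (hβ1 : β ≤ 1) :
    ∃ C, 0 < C ∧ ∀ l τ : ℝ, 0 < l → 0 < τ → ∀ n : ℕ, 1 ≤ n →
      l ^ β * |l * mlE α (l ^ (1 / α) * (n * τ)) + τ ^ (-α) * ∑ j ∈ Finset.range (n + 1),
          cqWeight α j * (mlE α (l ^ (1 / α) * ((n - j : ℕ) * τ)) - 1)| ≤
        C * τ * (n * τ) ^ (-1 - β * α) * l := by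
  obtain ⟨C, hC, h⟩ := exists_mlE_cq_error_le hα hα1
  refine ⟨C, hC, fun l τ hl hτ n hn => ?_⟩
  have hn0 : (0:ℝ) < n := by exact_mod_cast hn
  have hm := Real.rpow_pos_of_pos hl (1 / α)
  set m := l ^ (1 / α) with hm'
  have hma : m ^ (-α) = l⁻¹ := by
    rw [hm', ← Real.rpow_mul hl.le, one_div, mul_neg, inv_mul_cancel₀ hα.ne', Real.rpow_neg_one]
  have e1 : ∀ x : ℝ, m * (x * τ) = x * (m * τ) := fun x => by ring
  have e2 : τ ^ (-α) = l * (m * τ) ^ (-α) := by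
    rw [Real.mul_rpow hm.le hτ.le, hma, mul_inv_cancel_left₀ hl.ne']
  simp only [e1]
  rw [e2, mul_assoc l, ← mul_add, abs_mul, abs_of_pos hl]
  have hx : 0 < (n:ℝ) * (m * τ) := by positivity
  have hmin : min (((n:ℝ) * (m * τ)) ^ (-α)) 1 ≤ ((n:ℝ) * (m * τ)) ^ (-(β * α)) := by
    rcases le_total 1 ((n:ℝ) * (m * τ)) with h1 | h1
    · exact (min_le_left _ _).trans (Real.rpow_le_rpow_of_exponent_le h1 (by nlinarith))
    · exact (min_le_right _ _).trans
        (Real.one_le_rpow_of_pos_of_le_one_of_nonpos hx h1 (by nlinarith))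
  have e3 : ((n:ℝ) * (m * τ)) ^ (-(β * α)) = (l ^ β)⁻¹ * (n * τ) ^ (-(β * α)) := by
    rw [show (n:ℝ) * (m * τ) = m * (n * τ) by ring, Real.mul_rpow hm.le (by positivity),
      show -(β * α) = -α * β by ring, Real.rpow_mul hm.le, hma, Real.inv_rpow hl.le]
  have e4 : ((n:ℝ) * τ) ^ (-1 - β * α) = (n * τ)⁻¹ * (n * τ) ^ (-(β * α)) := by
    rw [sub_eq_add_neg, Real.rpow_add (by positivity), Real.rpow_neg_one]
  have hlb := Real.rpow_pos_of_pos hl β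
  calc _ ≤ l ^ β * (l * (C / n * ((n:ℝ) * (m * τ)) ^ (-(β * α)))) := by
        gcongr
        exact (h (m * τ) (by positivity) n hn).trans (by gcongr)
    _ = _ := by
        rw [e3, e4]
        field_simp

end FracCQ

/-- Consistency error of the backward Euler CQ for smooth initial data:
`‖A^β (∂_t^α u(t_n) - ∂̄_τ^α y(t_n))‖ ≤ c τ t_n^{-1-βα} ‖A v‖` where `y = u - v`. -/
theorem cq_consistency_smooth_data (α β : ℝ) (hα0 : 0 < α) (hα1 : α < 1)
    (hβ0 : 0 ≤ β) (hβ1 : β ≤ 1) :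
    ∃ c : ℝ, 0 < c ∧
      ∀ (V : Type) (_ : NormedAddCommGroup V) (_ : InnerProductSpace ℂ V)
        (_ : FiniteDimensional ℂ V) (_ : Nontrivial V)
        (A : V →L[ℂ] V), IsSelfAdjoint A →
        (∀ x : V, x ≠ 0 → 0 < (⟪A x, x⟫).re) →
        ∀ (v : V) (u u' : ℝ → V),
        ContinuousOn u (Set.Ici 0) → u 0 = v →
        (∀ t : ℝ, 0 < t → HasDerivAt u (u' t) t) →
        (∀ t : ℝ, 0 < t →
          MeasureTheory.IntegrableOn (fun s => (t - s) ^ (-α) * ‖u' s‖) (Set.Ioo 0 t)) →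
        (∀ t : ℝ, 0 < t → caputo α u' t + A (u t) = 0) →
        ∀ τ : ℝ, 0 < τ → ∀ n : ℕ, 1 ≤ n →
          ‖opRPow A β (caputo α u' ((n : ℝ) * τ)
              - τ ^ (-α) • ∑ j ∈ Finset.range (n + 1),
                  cqWeight α j • (u (((n - j : ℕ) : ℝ) * τ) - v))‖
            ≤ c * τ * ((n : ℝ) * τ) ^ (-1 - β * α) * ‖A v‖ := by
  obtain ⟨C, hC, h⟩ := FracCQ.exists_scalar_cq_error_le hα0 hα1 hβ0 hβ1
  refine ⟨C, hC, fun V _ _ _ _ A hA hpos v u u' hu hu0 hd hi he τ hτ n hn => ?_⟩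
  have hS := ContinuousLinearMap.isSelfAdjoint_iff_isSymmetric.1 hA
  set b := hS.eigenvectorBasis rfl with hb
  set l := hS.eigenvalues rfl with hl
  have hAb : ∀ i, A (b i) = l i • b i := fun i => by
    have := hS.apply_eigenvectorBasis rfl i
    exact this
  have hl0 : ∀ i, 0 < l i := fun i => by
    have h0 := hpos (b i) (norm_ne_zero_iff.1 (by rw [b.norm_eq_one]; exact one_ne_zero))
    rw [hAb, FracCQ.inner_ofReal_smul_left, Complex.smul_re, inner_self_eq_norm_sq_to_K,
      b.norm_eq_one] at h0
    simpa using h0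
  have hn0 : (0:ℝ) < n := by exact_mod_cast hn
  refine FracCQ.norm_le_mul_of_norm_inner_le b (by positivity) fun i => ?_
  have hsol : ∀ t : ℝ, 0 ≤ t → ⟪b i, u t⟫ = FracCQ.mlE α (l i ^ (1 / α) * t) • ⟪b i, v⟫ :=
    fun t ht => by
      rw [FracCQ.inner_eq_mlE_smul hα0 hα1 hA (hl0 i) (hAb i) hu hd hi he ht, hu0]
  rw [opRPow, FracCQ.inner_apply_of_eigenvector (cfc_predicate _ A)
    (FracCQ.cfc_apply_eigenvectorBasis hA b hAb _ i),
    FracCQ.inner_apply_of_eigenvector hA (hAb i),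
    eq_neg_of_add_eq_zero_left (he _ (mul_pos hn0 hτ))]
  have key : ⟪b i, -A (u (n * τ)) - τ ^ (-α) • ∑ j ∈ Finset.range (n + 1),
      cqWeight α j • (u (((n - j : ℕ) : ℝ) * τ) - v)⟫ =
      (-(l i * FracCQ.mlE α (l i ^ (1 / α) * (n * τ)) + τ ^ (-α) * ∑ j ∈ Finset.range (n + 1),
          cqWeight α j * (FracCQ.mlE α (l i ^ (1 / α) * ((n - j : ℕ) * τ)) - 1))) • ⟪b i, v⟫ := by
    have hsum : ⟪b i, ∑ j ∈ Finset.range (n + 1), cqWeight α j • (u (((n - j : ℕ) : ℝ) * τ) - v)⟫ =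
        (∑ j ∈ Finset.range (n + 1),
          cqWeight α j * (FracCQ.mlE α (l i ^ (1 / α) * ((n - j : ℕ) * τ)) - 1)) • ⟪b i, v⟫ := by
      rw [inner_sum, Finset.sum_smul]
      refine Finset.sum_congr rfl fun j _ => ?_
      rw [FracCQ.inner_ofReal_smul_right, inner_sub_right, hsol _ (by positivity), mul_smul,
        sub_smul, one_smul]
    rw [inner_sub_right, inner_neg_right, FracCQ.inner_apply_of_eigenvector hA (hAb i),
      hsol _ (by positivity), FracCQ.inner_ofReal_smul_right, hsum, smul_smul, smul_smul,
      ← neg_smul, ← sub_smul, neg_add']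
  rw [key, norm_smul, norm_smul, norm_smul, norm_neg, Real.norm_eq_abs, Real.norm_eq_abs,
    Real.norm_eq_abs, abs_of_pos (hl0 i), abs_of_nonneg (Real.rpow_nonneg (hl0 i).le β)]
  have := mul_le_mul_of_nonneg_right (h _ τ (hl0 i) hτ n hn) (norm_nonneg ⟪b i, v⟫)
  rwa [mul_assoc (l i ^ β), mul_assoc _ (l i)] at this
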